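/- arXiv:2408.02413 — 4 statements merged into one kernel-verified Lean document; each statement's English description precedes it below -/
import Mathlib

section
/- In PG(3,q), for any set T of q+1 lines that are pairwise disjoint, there exists a line of PG(3,q) disjoint from every member of T. -/
open Classical in
lemma card_filter_sub {F V : Type*} [Field F] [Fintype F] [AddCommGroup V] [Module F V]
    [Fintype V] (U : Submodule F V) :
    (Finset.univ.filter (fun x : V => x ∈ U)).card = Fintype.card F ^ Module.finrank F U := by
  rw [← Module.card_eq_pow_finrank (K := F) (V := U), Fintype.card_subtype]

open Classical in
lemma card_filter_sub_ne {F V : Type*} [Field F] [Fintype F] [AddCommGroup V] [Module F V]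
    [Fintype V] (U : Submodule F V) :
    (Finset.univ.filter (fun x : V => x ∈ U ∧ x ≠ 0)).card + 1
      = Fintype.card F ^ Module.finrank F U := by
  rw [← card_filter_sub]
  have : (Finset.univ.filter (fun x : V => x ∈ U ∧ x ≠ 0))
      = (Finset.univ.filter (fun x : V => x ∈ U)).erase 0 := by
    ext x; simp [and_comm]
  rw [this, Finset.card_erase_add_one]
  simp

open Classical in
/-- At most `q` subspaces, none containing `W`, do not cover `W`. -/
lemma cover_aux {F V : Type*} [Field F] [Fintype F] [AddCommGroup V] [Module F V]
    [Fintype V] {ι : Type*} (S : Finset ι) (f : ι → Submodule F V) (W : Submodule F V)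
    (hS : S.card ≤ Fintype.card F)
    (h : ∀ i ∈ S, ¬ W ≤ f i) : ∃ w ∈ W, ∀ i ∈ S, w ∉ f i := by
  by_contra! hc
  rcases S.eq_empty_or_nonempty with rfl | ⟨i0, hi0⟩
  · obtain ⟨i, hi, _⟩ := hc 0 W.zero_mem
    simp at hi
  have hq : 1 < Fintype.card F := Fintype.one_lt_card
  have hlt : ∀ i ∈ S, Module.finrank F (f i ⊓ W : Submodule F V) < Module.finrank F W := by
    intro i hi
    apply Submodule.finrank_lt_finrank_of_lt
    refine lt_of_le_of_ne inf_le_right ?_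
    intro he
    exact h i hi (inf_eq_right.mp he)
  obtain ⟨d, hd⟩ : ∃ d, Module.finrank F W = d + 1 :=
    ⟨Module.finrank F W - 1, by have := hlt i0 hi0; omega⟩
  have hsub : (Finset.univ.filter (fun x : V => x ∈ W ∧ x ≠ 0)) ⊆
      S.biUnion (fun i => Finset.univ.filter (fun x : V => x ∈ f i ⊓ W ∧ x ≠ 0)) := by
    intro x hx
    simp only [Finset.mem_filter, Finset.mem_univ, true_and] at hx
    obtain ⟨i, hi, hxi⟩ := hc x hx.1
    simp only [Finset.mem_biUnion, Finset.mem_filter, Finset.mem_univ, true_and]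
    exact ⟨i, hi, ⟨hxi, hx.1⟩, hx.2⟩
  have h1 := (Finset.card_le_card hsub).trans
    (Finset.card_biUnion_le_card_mul _ _ (Fintype.card F ^ d - 1) (by
      intro i hi
      have h2 := card_filter_sub_ne (f i ⊓ W)
      have h3 : Fintype.card F ^ Module.finrank F (f i ⊓ W : Submodule F V)
          ≤ Fintype.card F ^ d :=
        Nat.pow_le_pow_right (by omega) (by have := hlt i hi; omega)
      omega))
  have h4 := card_filter_sub_ne W
  rw [hd, pow_succ] at h4
  have h5 : 1 ≤ Fintype.card F ^ d := Nat.one_le_pow _ _ (by omega)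
  obtain ⟨e, he⟩ : ∃ e, Fintype.card F ^ d = e + 1 := ⟨_, (Nat.sub_add_cancel h5).symm⟩
  rw [he] at h1 h4
  simp only [Nat.add_sub_cancel] at h1
  have h6 := Nat.mul_le_mul_right e hS
  nlinarith

/-- In `PG(3,q)` (lines: 2-dimensional subspaces of `F_q^4`, two lines being
disjoint iff the corresponding subspaces intersect trivially), any set of `q+1`
pairwise disjoint lines admits a line disjoint from all of them. -/
theorem stmt2 (q : ℕ) (F : Type*) [Field F] [Fintype F] (hq : Fintype.card F = q)
    (T : Set (Submodule F (Fin 4 → F)))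
    (hTlines : ∀ M ∈ T, Module.finrank F M = 2)
    (hcard : T.ncard = q + 1)
    (hdisj : ∀ M ∈ T, ∀ N ∈ T, M ≠ N → M ⊓ N = ⊥) :
    ∃ L : Submodule F (Fin 4 → F), Module.finrank F L = 2 ∧
      ∀ M ∈ T, L ⊓ M = ⊥ := by
  classical
  have hq2 : 1 < Fintype.card F := Fintype.one_lt_card
  have hfin : T.Finite := Set.finite_of_ncard_pos (by omega)
  obtain ⟨S, rfl⟩ := hfin.exists_finset_coe
  rw [Set.ncard_coe_finset] at hcard
  simp only [Finset.mem_coe] at *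
  have hdis : ∀ M ∈ S, ∀ N ∈ S, M ≠ N → ∀ x, x ∈ M → x ∈ N → x = 0 := by
    intro M hM N hN hne x hx hx'
    have : x ∈ M ⊓ N := ⟨hx, hx'⟩
    rw [hdisj M hM N hN hne] at this
    simpa using this
  -- a point outside all lines
  obtain ⟨p, hp⟩ : ∃ p : Fin 4 → F, ∀ X ∈ S, p ∉ X := by
    by_contra! hc
    have hsub : (Finset.univ : Finset (Fin 4 → F)) ⊆
        S.biUnion (fun X => Finset.univ.filter (fun x => x ∈ X)) := by
      intro x _
      simpa using hc x
    have h1 := (Finset.card_le_card hsub).trans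
      (Finset.card_biUnion_le_card_mul _ _ (q ^ 2) (by
        intro X hX
        rw [card_filter_sub, hTlines X hX, hq]))
    rw [hcard] at h1
    simp only [Finset.card_univ, Fintype.card_pi, Finset.prod_const, Fintype.card_fin, hq] at h1
    have : q + 1 < q ^ 2 ∨ q = 2 := by
      rcases Nat.lt_or_ge 2 q with h | h
      · left; nlinarith
      · right; omega
    rcases this with h | h
    · have : 0 < q ^ 2 := pow_pos (by omega) 2
      nlinarith
    · subst h; omega
  have hp0 : ∀ X ∈ S, p ≠ 0 := fun X hX h => hp X hX (h ▸ X.zero_mem)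
  obtain ⟨A, hA, B, hB, hAB⟩ := Finset.one_lt_card.mp (show 1 < S.card by omega)
  have hsup : A ⊔ B = ⊤ := by
    apply Submodule.eq_top_of_finrank_eq
    have := Submodule.finrank_sup_add_finrank_inf_eq A B
    rw [hdisj A hA B hB hAB, hTlines A hA, hTlines B hB] at this
    simpa using this
  obtain ⟨a, ha, b, hb, hab⟩ := Submodule.mem_sup.mp (hsup ▸ Submodule.mem_top : p ∈ A ⊔ B)
  have ha0 : a ≠ 0 := by
    rintro rfl
    exact hp B hB (by rw [← hab]; simpa using hb)
  let g : Submodule F (Fin 4 → F) → Submodule F (Fin 4 → F) := fun X => X ⊔ F ∙ p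
  have hg : ∀ X x, x ∈ g X ↔ ∃ t : F, x + t • p ∈ X := by
    intro X x
    simp only [g, Submodule.mem_sup, Submodule.mem_span_singleton]
    constructor
    · rintro ⟨y, hy, z, ⟨t, rfl⟩, rfl⟩
      exact ⟨-t, by simpa using hy⟩
    · rintro ⟨t, ht⟩
      exact ⟨_, ht, _, ⟨-t, rfl⟩, by simp⟩
  have hpg : ∀ X, p ∈ g X := fun X => (hg X p).2 ⟨-1, by simp⟩
  have haA : a ∈ g A := (hg _ _).2 ⟨0, by simpa using ha⟩
  have haB : a ∈ g B := (hg _ _).2 ⟨-1, by rw [← hab]; simpa using hb⟩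
  obtain ⟨C, hC, haC⟩ : ∃ C ∈ S, a ∉ g C := by
    by_contra! hc
    have hc' : ∀ X, ∃ t : F, X ∈ S → a + t • p ∈ X := by
      intro X
      by_cases hX : X ∈ S
      · obtain ⟨t, ht⟩ := (hg X a).1 (hc X hX)
        exact ⟨t, fun _ => ht⟩
      · exact ⟨0, fun h => absurd h hX⟩
    choose t ht using hc'
    obtain ⟨X, hX, Y, hY, hXY, hXYt⟩ := Finset.exists_ne_map_eq_of_card_lt_of_maps_to
      (s := S) (t := Finset.univ) (f := t) (by rw [Finset.card_univ]; omega)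
      (fun _ _ => Finset.mem_coe.2 (Finset.mem_univ _))
    have h0 := hdis X hX Y hY hXY _ (ht X hX) (hXYt ▸ ht Y hY)
    by_cases htz : t X = 0
    · rw [htz] at h0; simp at h0; exact ha0 h0
    · apply hp A hA
      have : t X • p ∈ A := by
        rw [show t X • p = -a from (neg_eq_of_add_eq_zero_right h0).symm]
        exact A.neg_mem ha
      exact (A.smul_mem_iff htz).1 this
  obtain ⟨v, -, hv⟩ := cover_aux (S.erase C) g ⊤
    (by rw [Finset.card_erase_of_mem hC]; omega) (by
      intro X hX htop
      have h1 := Submodule.finrank_add_le_finrank_add_finrank X (F ∙ p)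
      rw [hTlines X (Finset.mem_of_mem_erase hX), finrank_span_singleton (hp0 C hC)] at h1
      have h2 : X ⊔ F ∙ p = ⊤ := top_le_iff.mp htop
      rw [h2] at h1
      simp at h1)
  have hBC : B ≠ C := by rintro rfl; exact haC haB
  have hvB : v ∉ g B := hv B (Finset.mem_erase.2 ⟨hBC, hB⟩)
  obtain ⟨w, hwn, hw⟩ := cover_aux (S.erase B) g (Submodule.span F {p, a, v})
    (by rw [Finset.card_erase_of_mem hB]; omega) (by
      intro X hX hle
      by_cases hXC : X = C
      · subst hXC
        exact haC (hle (Submodule.subset_span (by simp)))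
      · exact hv X (Finset.mem_erase.2 ⟨hXC, Finset.mem_of_mem_erase hX⟩)
          (hle (Submodule.subset_span (by simp))))
  have hwall : ∀ X ∈ S, w ∉ g X := by
    intro X hX hwX
    by_cases hXB : X = B
    · subst hXB
      apply hw A (Finset.mem_erase.2 ⟨hAB, hA⟩)
      obtain ⟨α, β, γ, rfl⟩ := Submodule.mem_span_triple.1 hwn
      have hpa : α • p + β • a ∈ g X :=
        add_mem (Submodule.smul_mem _ _ (hpg _)) (Submodule.smul_mem _ _ haB)
      have hvv : γ • v ∈ g X := (Submodule.add_mem_iff_right _ hpa).1 hwX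
      have hγ : γ = 0 := by
        by_contra hne
        exact hvB ((Submodule.smul_mem_iff _ hne).1 hvv)
      subst hγ
      rw [zero_smul, add_zero]
      exact add_mem (Submodule.smul_mem _ _ (hpg _)) (Submodule.smul_mem _ _ haA)
    · exact hw X (Finset.mem_erase.2 ⟨hXB, hX⟩) hwX
  have key : ∀ X ∈ S, ∀ s t : F, s • p + t • w ∈ X → s = 0 ∧ t = 0 := by
    intro X hX s t hst
    have ht : t = 0 := by
      by_contra hne
      apply hwall X hX
      have h1 : s • p + t • w ∈ g X := (hg _ _).2 ⟨0, by simpa using hst⟩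
      exact (Submodule.smul_mem_iff _ hne).1
        ((Submodule.add_mem_iff_right _ (Submodule.smul_mem _ _ (hpg _))).1 h1)
    subst ht
    refine ⟨?_, rfl⟩
    by_contra hne
    rw [zero_smul, add_zero] at hst
    exact hp X hX ((Submodule.smul_mem_iff _ hne).1 hst)
  have hli : LinearIndependent F ![p, w] := by
    rw [LinearIndependent.pair_iff]
    intro s t h
    exact key A hA s t (h ▸ A.zero_mem)
  refine ⟨Submodule.span F (Set.range ![p, w]), ?_, ?_⟩
  · rw [finrank_span_eq_card hli]; simp
  · intro M hM
    rw [eq_bot_iff]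
    rintro x ⟨hx, hxM⟩
    have hx' : x ∈ Submodule.span F {p, w} := by simpa [Set.pair_comm] using hx
    obtain ⟨s, t, rfl⟩ := Submodule.mem_span_pair.1 hx'
    obtain ⟨rfl, rfl⟩ := key M hM s t hxM
    simp
end

section
/- Let 0 ≤ k < n and let q be a prime power. If T is a set of q+1 projective k-dimensional subspaces of PG(n,q) such that no projective (n−k−1)-dimensional subspace of PG(n,q) is disjoint from every member of T, then there exist a (k−1)-dimensional subspace U and a (k+1)-dimensional subspace W with U ⊆ W such that T equals the set of all k-dimensional subspaces X with U ⊆ X ⊆ W. -/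
section aux
open Classical Finset Module
variable {F V : Type*} [Field F] [Fintype F] [AddCommGroup V] [Module F V] [Fintype V]

noncomputable def fsub (X : Submodule F V) : Finset V := Finset.univ.filter (· ∈ X)

lemma mem_fsub (X : Submodule F V) (x : V) : x ∈ fsub X ↔ x ∈ X := by simp [fsub]

lemma card_fsub (X : Submodule F V) : (fsub X).card = Fintype.card F ^ finrank F X := by
  rw [fsub, ← Fintype.card_subtype]
  exact Module.card_eq_pow_finrank (K := F) (V := X)

lemma card_fsub_sdiff (X A : Submodule F V) :
    (fsub X \ fsub A).card + Fintype.card F ^ finrank F (X ⊓ A : Submodule F V)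
      = Fintype.card F ^ finrank F X := by
  have h : fsub X ∩ fsub A = fsub (X ⊓ A) := by
    ext x; simp [mem_fsub]
  rw [← card_fsub, ← card_fsub, ← h]
  exact Finset.card_sdiff_add_card_inter _ _

/-- counting: few small subspaces do not cover -/
lemma exists_uncovered (S : Finset (Submodule F V)) (m : ℕ)
    (hS : ∀ X ∈ S, finrank F X = m)
    (h : S.card * (Fintype.card F ^ m - 1) + 1 < Fintype.card F ^ finrank F V) :
    ∃ v : V, ∀ X ∈ S, v ∉ X := by
  by_contra! hc
  have hsub : (Finset.univ : Finset V) ⊆ {0} ∪ S.biUnion (fun X => fsub X \ {0}) := by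
    intro v _
    obtain ⟨X, hX, hv⟩ := hc v
    by_cases h0 : v = 0
    · simp [h0]
    · simp only [Finset.mem_union, Finset.mem_biUnion]
      right
      exact ⟨X, hX, by simp [mem_fsub, hv, h0]⟩
  have h1 := Finset.card_le_card hsub
  rw [Finset.card_univ, Module.card_eq_pow_finrank (K := F) (V := V)] at h1
  have h2 := Finset.card_union_le ({0} : Finset V) (S.biUnion (fun X => fsub X \ {0}))
  have h3 : (S.biUnion (fun X => fsub X \ {0})).card ≤ S.card * (Fintype.card F ^ m - 1) := by
    apply Finset.card_biUnion_le_card_mul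
    intro X hX
    rw [Finset.card_sdiff_of_subset, card_fsub, hS X hX]
    · simp
    · simp [mem_fsub]
  simp only [Finset.card_singleton] at h2
  omega

lemma tight_cover {ι α : Type*} (S : Finset ι) (f : ι → Finset α) (D : Finset α) (c : ℕ)
    (hc : ∀ i ∈ S, (f i).card ≤ c) (hD : S.card * c ≤ D.card) (hcov : D ⊆ S.biUnion f) :
    (∀ i ∈ S, (f i).card = c) ∧ ∀ i ∈ S, ∀ j ∈ S, i ≠ j → ∀ x ∈ f i, x ∉ f j := by
  have key : ∀ i ∈ S, ∀ g : Finset α, D ⊆ g ∪ (S.erase i).biUnion f → c ≤ g.card := by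
    intro i hi g hg
    have h1 := (Finset.card_le_card hg).trans (Finset.card_union_le _ _)
    have h2 : ((S.erase i).biUnion f).card ≤ (S.erase i).card * c :=
      Finset.card_biUnion_le_card_mul _ _ _ (fun j hj => hc j (Finset.mem_of_mem_erase hj))
    have h3 := Finset.card_erase_add_one hi
    rw [← h3, add_mul] at hD
    omega
  constructor
  · intro i hi
    refine le_antisymm (hc i hi) (key i hi _ ?_)
    intro x hx
    have := hcov hx
    simp only [Finset.mem_union, Finset.mem_biUnion, Finset.mem_erase] at this ⊢
    grind
  · intro i hi j hj hij x hxi hxj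
    have := key i hi ((f i).erase x) (by
      intro y hy
      have := hcov hy
      simp only [Finset.mem_union, Finset.mem_biUnion, Finset.mem_erase] at this ⊢
      grind)
    have h1 := hc i hi
    have := Finset.card_erase_add_one hxi
    omega

lemma finrank_sup_span (X : Submodule F V) (v : V) (hv : v ∉ X) :
    finrank F (X ⊔ F ∙ v : Submodule F V) = finrank F X + 1 := by
  have h0 : v ≠ 0 := by rintro rfl; exact hv X.zero_mem
  have h := Submodule.finrank_sup_add_finrank_inf_eq X (F ∙ v)
  have h1 : X ⊓ F ∙ v = ⊥ := by
    rw [← disjoint_iff]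
    exact (Submodule.disjoint_span_singleton_of_notMem hv)
  rw [h1, finrank_span_singleton h0] at h
  simpa using h

/-- lifting a common complement. -/
lemma lift_compl (S : Finset (Submodule F V)) (v : V) (hv0 : v ≠ 0) (hv : ∀ X ∈ S, v ∉ X) (c : ℕ)
    (hne : S.Nonempty)
    (h : ∃ Y : Submodule F V, finrank F Y = c ∧
      ∀ X ∈ S.image (fun X => X ⊔ F ∙ v), Disjoint Y X) :
    ∃ Y : Submodule F V, finrank F Y = c + 1 ∧ ∀ X ∈ S, Disjoint Y X := by
  obtain ⟨Y, hY, hd⟩ := h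
  have hd' : ∀ X ∈ S, Disjoint Y (X ⊔ F ∙ v) := fun X hX =>
    hd _ (Finset.mem_image_of_mem _ hX)
  refine ⟨Y ⊔ F ∙ v, ?_, ?_⟩
  · rw [finrank_sup_span, hY]
    intro hvY
    obtain ⟨X, hX⟩ := hne
    have := (Submodule.disjoint_def.1 (hd' X hX)) v hvY
      (Submodule.mem_sup_right (Submodule.mem_span_singleton_self v))
    exact hv0 this
  · intro X hX
    have h1 : Disjoint X (F ∙ v) := Submodule.disjoint_span_singleton_of_notMem (hv X hX)
    have h2 := hd' X hX
    rw [sup_comm] at h2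
    exact Disjoint.disjoint_sup_left_of_disjoint_sup_right h1.symm h2

lemma weak (c m : ℕ) (S : Finset (Submodule F V)) (hS : ∀ X ∈ S, finrank F X = m)
    (hV : m + c = finrank F V) (hcard : S.card ≤ Fintype.card F) (hne : S.Nonempty) :
    ∃ Y : Submodule F V, finrank F Y = c ∧ ∀ X ∈ S, Disjoint Y X := by
  induction c generalizing m S with
  | zero => exact ⟨⊥, by simp, by simp⟩
  | succ c ih =>
    have hq : 1 < Fintype.card F := Fintype.one_lt_card
    obtain ⟨v, hv⟩ := exists_uncovered S m hS (by
      have h1 : Fintype.card F ^ (m+1) ≤ Fintype.card F ^ finrank F V :=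
        Nat.pow_le_pow_right (by omega) (by omega)
      have h2 : 1 ≤ Fintype.card F ^ m := Nat.one_le_pow _ _ (by omega)
      refine lt_of_lt_of_le ?_ h1
      obtain ⟨Q, hQ⟩ := Nat.exists_eq_add_of_le h2
      rw [pow_succ, hQ]
      simp only [Nat.add_sub_cancel_left]
      nlinarith)
    obtain ⟨X0, hX0⟩ := hne
    have hv0 : v ≠ 0 := by rintro rfl; exact hv X0 hX0 X0.zero_mem
    apply lift_compl S v hv0 hv c ⟨X0, hX0⟩
    apply ih (m + 1)
    · intro X hX
      obtain ⟨Z, hZ, rfl⟩ := Finset.mem_image.1 hX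
      rw [finrank_sup_span _ _ (hv Z hZ), hS Z hZ]
    · omega
    · exact Finset.card_image_le.trans hcard
    · exact ⟨_, Finset.mem_image_of_mem _ hX0⟩

/-- Lemma E -/
lemma tight_hyper (k : ℕ) (T : Finset (Submodule F V)) (hT : ∀ X ∈ T, finrank F X = k + 1)
    (hcard : T.card = Fintype.card F + 1) (W A : Submodule F V) (hW : finrank F W = k + 2)
    (hA : A ∈ T) (hAW : A ≤ W) (hcov : ∀ x ∈ W, ∃ X ∈ T, x ∈ X) :
    (∀ X ∈ T, X ≤ W) ∧ ∀ X ∈ T, ∀ Y ∈ T, X ≠ Y → X ≠ A → Y ≠ A → X ⊓ Y ≤ A := by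
  set q := Fintype.card F with hq
  have hq1 : 1 < q := Fintype.one_lt_card
  have hbound : ∀ X ∈ T, (fsub (X ⊓ W) \ fsub A).card ≤ q ^ (k+1) - q ^ k ∧
      ((fsub (X ⊓ W) \ fsub A).card = q ^ (k+1) - q ^ k → X ≤ W) := by
    intro X hX
    have h1 := card_fsub_sdiff (X ⊓ W) A
    have h2 := Submodule.finrank_sup_add_finrank_inf_eq (X ⊓ W) A
    have h3 : finrank F (X ⊓ W ⊔ A : Submodule F V) ≤ k + 2 := by
      rw [← hW]; exact Submodule.finrank_mono (sup_le inf_le_right hAW)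
    have h4 : finrank F (X ⊓ W ⊓ A : Submodule F V) ≤ finrank F (X ⊓ W : Submodule F V) :=
      Submodule.finrank_mono inf_le_left
    have h5 : finrank F (X ⊓ W : Submodule F V) ≤ k + 1 := by
      rw [← hT X hX]; exact Submodule.finrank_mono inf_le_left
    have h6 : finrank F (X ⊓ W : Submodule F V) = k + 1 → X ≤ W := by
      intro h
      have := Submodule.eq_of_le_of_finrank_eq (inf_le_left : X ⊓ W ≤ X) (by rw [h, hT X hX])
      exact inf_eq_left.1 this
    rw [hT A hA] at h2
    rw [← hq] at h1
    set d := finrank F (X ⊓ W : Submodule F V)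
    set e := finrank F (X ⊓ W ⊓ A : Submodule F V)
    have hpk : q ^ k < q ^ (k+1) := Nat.pow_lt_pow_right hq1 (by omega)
    have : d = e ∨ d = e + 1 := by omega
    rcases this with h | h
    · rw [h] at h1
      constructor
      · omega
      · intro; omega
    · by_cases hek : e = k
      · subst hek
        rw [h] at h1
        exact ⟨by omega, fun _ => h6 h⟩
      · have hlt : e < k := by omega
        have hpe : q ^ e < q ^ k := Nat.pow_lt_pow_right hq1 hlt
        rw [h] at h1
        have : (q ^ (e+1) - q ^ e) < q ^ (k+1) - q ^ k := by
          rw [pow_succ, pow_succ]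
          rw [← Nat.mul_sub_one, ← Nat.mul_sub_one]
          exact Nat.mul_lt_mul_of_pos_right hpe (by omega)
        constructor
        · omega
        · intro; omega
  have hAk := hT A hA
  have hDc := card_fsub_sdiff W A
  rw [inf_eq_right.2 hAW, hAk, hW, ← hq] at hDc
  have hTe : (T.erase A).card = q := by rw [Finset.card_erase_of_mem hA, hcard]; rfl
  have ht := tight_cover (T.erase A) (fun X => fsub (X ⊓ W) \ fsub A) (fsub W \ fsub A)
    (q ^ (k+1) - q ^ k) (fun X hX => (hbound X (Finset.mem_of_mem_erase hX)).1) (by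
      rw [hTe, Nat.mul_sub]
      have e1 : q * q ^ (k+1) = q ^ (k+2) := by ring
      have e2 : q * q ^ k = q ^ (k+1) := by ring
      omega) (by
      intro x hx
      simp only [Finset.mem_sdiff, mem_fsub] at hx
      obtain ⟨X, hX, hxX⟩ := hcov x hx.1
      simp only [Finset.mem_biUnion, Finset.mem_sdiff, mem_fsub, Finset.mem_erase]
      refine ⟨X, ⟨?_, hX⟩, ⟨hxX, hx.1⟩, hx.2⟩
      rintro rfl
      exact hx.2 hxX)
  have hle : ∀ X ∈ T, X ≤ W := by
    intro X hX
    by_cases h : X = A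
    · rw [h]; exact hAW
    · exact (hbound X hX).2 (ht.1 X (Finset.mem_erase.2 ⟨h, hX⟩))
  refine ⟨hle, ?_⟩
  intro X hX Y hY hXY hXA hYA x hx
  by_contra hxA
  refine ht.2 X (Finset.mem_erase.2 ⟨hXA, hX⟩) Y (Finset.mem_erase.2 ⟨hYA, hY⟩) hXY x ?_ ?_
  · simp only [Finset.mem_sdiff, mem_fsub]
    exact ⟨⟨hx.1, hle X hX hx.1⟩, hxA⟩
  · simp only [Finset.mem_sdiff, mem_fsub]
    exact ⟨⟨hx.2, hle X hX hx.1⟩, hxA⟩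

/-- Lemma L -/
lemma cover_of_inf_le (d : ℕ) (H : Finset (Submodule F V)) (W K : Submodule F V)
    (hW : finrank F W = d + 1) (hH : ∀ X ∈ H, finrank F X = d ∧ X ≤ W)
    (hcard : H.card = Fintype.card F + 1)
    (hK : ∀ X ∈ H, ∀ Y ∈ H, X ≠ Y → X ⊓ Y ≤ K) (v : V) (hvW : v ∈ W) (hvK : v ∉ K) :
    ∃ X ∈ H, v ∈ X := by
  by_contra! hun
  set q := Fintype.card F with hq
  have hq1 : 1 < q := Fintype.one_lt_card
  obtain ⟨f, hfv, hKf⟩ := Submodule.exists_le_ker_of_notMem hvK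
  set N := W ⊓ LinearMap.ker f with hN
  have hNW : N ≤ W := inf_le_left
  have hvN : v ∉ N := fun h => hfv h.2
  have hlt : N < W := lt_of_le_of_ne hNW (fun h => hvN (h ▸ hvW))
  have hNd1 : finrank F N < d + 1 := hW ▸ Submodule.finrank_lt_finrank_of_lt hlt
  have hNd : d ≤ finrank F N := by
    have h1 := Submodule.finrank_sup_add_finrank_inf_eq W (LinearMap.ker f)
    have h2 := LinearMap.finrank_range_add_finrank_ker f
    have h3 : finrank F (LinearMap.range f) ≤ 1 := by
      simpa using Submodule.finrank_le (LinearMap.range f)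
    have h4 := Submodule.finrank_le (W ⊔ LinearMap.ker f)
    rw [← hN] at h1
    omega
  have hNd : finrank F N = d := by omega
  have hd : d ≠ 0 := by
    rintro rfl
    have : H ⊆ {⊥} := by
      intro X hX
      simpa using Submodule.finrank_eq_zero.1 (hH X hX).1
    have := Finset.card_le_card this
    simp at this
    omega
  obtain ⟨d, rfl⟩ := Nat.exists_eq_succ_of_ne_zero hd
  have hX : ∀ X ∈ H.erase N, q ^ (d+1) - q ^ d ≤ (fsub X \ fsub N).card := by
    intro X hX
    obtain ⟨hXN, hX⟩ := Finset.mem_erase.1 hX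
    have h1 := card_fsub_sdiff X N
    have h2 : X ⊓ N < X := by
      refine lt_of_le_of_ne inf_le_left (fun h => hXN ?_)
      exact Submodule.eq_of_le_of_finrank_eq (inf_eq_left.1 h) (by rw [hNd, (hH X hX).1])
    have h3 := Submodule.finrank_lt_finrank_of_lt h2
    rw [(hH X hX).1] at h1 h3
    have h4 : q ^ finrank F (X ⊓ N : Submodule F V) ≤ q ^ d :=
      Nat.pow_le_pow_right (by omega) (by omega)
    simp only [← hq, Nat.succ_eq_add_one] at *
    omega
  have hdisj : ((H.erase N : Finset _) : Set (Submodule F V)).PairwiseDisjoint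
      (fun X => fsub X \ fsub N) := by
    intro X hX Y hY hXY
    have hX' := Finset.mem_of_mem_erase hX
    have hY' := Finset.mem_of_mem_erase hY
    simp only [Function.onFun]
    rw [Finset.disjoint_left]
    intro x hx hy
    simp only [Finset.mem_sdiff, mem_fsub] at hx hy
    exact hx.2 ⟨(hH X hX').2 hx.1, hKf (hK X hX' Y hY' hXY ⟨hx.1, hy.1⟩)⟩
  have hc1 := Finset.card_biUnion hdisj
  have hc2 := Finset.card_nsmul_le_sum _ _ _ hX
  rw [← hc1] at hc2
  have hc3 : (H.erase N).biUnion (fun X => fsub X \ fsub N) ⊆ (fsub W \ fsub N).erase v := by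
    intro x hx
    simp only [Finset.mem_biUnion, Finset.mem_sdiff, mem_fsub] at hx
    obtain ⟨X, hXm, hxX, hxN⟩ := hx
    have hX' := Finset.mem_of_mem_erase hXm
    simp only [Finset.mem_erase, Finset.mem_sdiff, mem_fsub]
    refine ⟨?_, (hH X hX').2 hxX, hxN⟩
    rintro rfl
    exact hun X hX' hxX
  have hc4 := Finset.card_le_card hc3
  have hvm : v ∈ fsub W \ fsub N := by simp [mem_fsub, hvW, hvN]
  have hc5 := Finset.card_erase_add_one hvm
  have hc6 := card_fsub_sdiff W N
  rw [inf_eq_right.2 hNW, hNd, hW, ← hq] at hc6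
  have hc7 : q ≤ (H.erase N).card := by
    have := Finset.pred_card_le_card_erase (s := H) (a := N)
    omega
  have hc8 : q * (q ^ (d+1) - q ^ d) ≤ (H.erase N).card * (q ^ (d+1) - q ^ d) :=
    Nat.mul_le_mul_right _ hc7
  rw [smul_eq_mul] at hc2
  rw [Nat.mul_sub] at hc8
  have e1 : q * q ^ (d+1) = q ^ (d+2) := by ring
  have e2 : q * q ^ d = q ^ (d+1) := by ring
  have e3 : q ^ (d+1) ≤ q ^ (d+2) := Nat.pow_le_pow_right (by omega) (by omega)
  have e4 : q ^ (d.succ + 1) = q ^ (d+2) := rfl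
  have e5 : q ^ d.succ = q ^ (d+1) := rfl
  omega

lemma image_sup_card (c m : ℕ) (T : Finset (Submodule F V)) (hT : ∀ X ∈ T, finrank F X = m)
    (hV : m + (c + 1) = finrank F V) (hcard : T.card = Fintype.card F + 1)
    (hblock : ¬ ∃ Y : Submodule F V, finrank F Y = c + 1 ∧ ∀ X ∈ T, Disjoint Y X)
    (v : V) (hv : ∀ X ∈ T, v ∉ X) :
    (∀ X ∈ T.image (fun X => X ⊔ F ∙ v), finrank F X = m + 1) ∧
    (T.image (fun X => X ⊔ F ∙ v)).card = Fintype.card F + 1 ∧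
    (¬ ∃ Y : Submodule F V, finrank F Y = c ∧
      ∀ X ∈ T.image (fun X => X ⊔ F ∙ v), Disjoint Y X) ∧
    (∀ X ∈ T, ∀ Y ∈ T, X ≠ Y → X ⊔ F ∙ v ≠ Y ⊔ F ∙ v) := by
  have hne : T.Nonempty := by
    rw [← Finset.card_pos]; omega
  have hv0 : v ≠ 0 := by
    obtain ⟨X0, hX0⟩ := hne
    rintro rfl; exact hv X0 hX0 X0.zero_mem
  have h1 : ∀ X ∈ T.image (fun X => X ⊔ F ∙ v), finrank F X = m + 1 := by
    intro X hX
    obtain ⟨Z, hZ, rfl⟩ := Finset.mem_image.1 hX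
    rw [finrank_sup_span _ _ (hv Z hZ), hT Z hZ]
  have h2 : ¬ ∃ Y : Submodule F V, finrank F Y = c ∧
      ∀ X ∈ T.image (fun X => X ⊔ F ∙ v), Disjoint Y X :=
    fun h => hblock (lift_compl T v hv0 hv c hne h)
  have h3 : (T.image (fun X => X ⊔ F ∙ v)).card = Fintype.card F + 1 := by
    apply le_antisymm
    · rw [← hcard]; exact Finset.card_image_le
    · by_contra hlt
      exact h2 (weak c (m+1) _ h1 (by omega) (by omega) (hne.image _))
  refine ⟨h1, h3, h2, ?_⟩
  have hinj := Finset.card_image_iff.1 (h3.trans hcard.symm)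
  intro X hX Y hY hXY h
  exact hXY (hinj hX hY h)

lemma main_aux (c k : ℕ) (T : Finset (Submodule F V)) (hT : ∀ X ∈ T, finrank F X = k + 1)
    (hV : (k + 1) + (c + 1) = finrank F V) (hcard : T.card = Fintype.card F + 1)
    (hblock : ¬ ∃ Y : Submodule F V, finrank F Y = c + 1 ∧ ∀ X ∈ T, Disjoint Y X) :
    ∃ U W : Submodule F V, finrank F U = k ∧ finrank F W = k + 2 ∧
      ∀ X ∈ T, U ≤ X ∧ X ≤ W := by
  have hq1 : 1 < Fintype.card F := Fintype.one_lt_card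
  induction c using Nat.strong_induction_on generalizing k T with
  | _ c ih =>
  by_cases hpair : ∃ X ∈ T, ∃ Y ∈ T, X ≠ Y ∧ finrank F (X ⊔ Y : Submodule F V) = k + 2
  · clear ih
    obtain ⟨X, hX, Y, hY, hXY, hr⟩ := hpair
    have hcov : ∀ x ∈ X ⊔ Y, ∃ Z ∈ T, x ∈ Z := by
      by_contra! hc
      obtain ⟨v, hvW, hv⟩ := hc
      obtain ⟨-, -, -, h4⟩ := image_sup_card c (k+1) T hT hV hcard hblock v hv
      apply h4 X hX Y hY hXY
      have hs : ∀ Z ∈ T, Z ≤ X ⊔ Y → Z ⊔ F ∙ v = X ⊔ Y := by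
        intro Z hZ hle
        apply Submodule.eq_of_le_of_finrank_eq
        · exact sup_le hle (by simpa using hvW)
        · rw [finrank_sup_span _ _ (hv Z hZ), hT Z hZ, hr]
      rw [hs X hX le_sup_left, hs Y hY le_sup_right]
    obtain ⟨hW, -⟩ := tight_hyper k T hT hcard (X ⊔ Y) X hr hX le_sup_left hcov
    refine ⟨X ⊓ Y, X ⊔ Y, ?_, hr, ?_⟩
    · have := Submodule.finrank_sup_add_finrank_inf_eq X Y
      rw [hr, hT X hX, hT Y hY] at this
      omega
    · intro A hA
      refine ⟨?_, hW A hA⟩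
      by_cases hXA : X = A
      · exact hXA ▸ inf_le_left
      by_cases hYA : Y = A
      · exact hYA ▸ inf_le_right
      exact (tight_hyper k T hT hcard (X ⊔ Y) A hr hA (hW A hA) hcov).2 X hX Y hY hXY hXA hYA
  · exfalso
    push Not at hpair
    -- all pairs span at least `k + 3`
    have hbig : ∀ X ∈ T, ∀ Y ∈ T, X ≠ Y → k + 3 ≤ finrank F (X ⊔ Y : Submodule F V) := by
      intro X hX Y hY hXY
      have h1 := hpair X hX Y hY hXY
      have h2 : finrank F X < finrank F (X ⊔ Y : Submodule F V) := by
        apply Submodule.finrank_lt_finrank_of_lt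
        refine lt_of_le_of_ne le_sup_left (fun h => hXY ?_)
        exact (Submodule.eq_of_le_of_finrank_eq (sup_eq_left.1 h.symm)
          (by rw [hT X hX, hT Y hY])).symm
      rw [hT X hX] at h2
      omega
    obtain ⟨X0, hX0, Y0, hY0, hXY0⟩ := Finset.one_lt_card.1 (show 1 < T.card by omega)
    have hc : c ≠ 0 := by
      rintro rfl
      have h1 := hbig X0 hX0 Y0 hY0 hXY0
      have h2 := Submodule.finrank_le (X0 ⊔ Y0)
      omega
    obtain ⟨c, rfl⟩ := Nat.exists_eq_succ_of_ne_zero hc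
    have hcount : ∀ N, N ≤ Fintype.card F + 2 →
        N * (Fintype.card F ^ (k+1) - 1) + 1 < Fintype.card F ^ finrank F V := by
      intro N hN
      have h1 : Fintype.card F ^ (k+1+2) ≤ Fintype.card F ^ finrank F V :=
        Nat.pow_le_pow_right (by omega) (by omega)
      refine lt_of_lt_of_le ?_ h1
      have h2 : 1 ≤ Fintype.card F ^ (k+1) := Nat.one_le_pow _ _ (by omega)
      rw [pow_add _ (k+1) 2]
      generalize Fintype.card F = q at *
      obtain ⟨Q, hQ⟩ := Nat.exists_eq_add_of_le h2
      rw [hQ]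
      simp only [Nat.add_sub_cancel_left]
      have h3 : N * Q ≤ (q + 2) * Q := Nat.mul_le_mul_right _ hN
      have h4 : q + 2 ≤ q ^ 2 := by nlinarith
      have h5 : (q + 2) * Q ≤ q ^ 2 * Q := Nat.mul_le_mul_right _ h4
      nlinarith
    have hU : ∀ v : V, (∀ X ∈ T, v ∉ X) → ∃ U : Submodule F V, finrank F U = k + 1 ∧ v ∈ U ∧
        (∀ X ∈ T, U ≤ X ⊔ F ∙ v) ∧ (∀ X ∈ T, ∀ Y ∈ T, X ≠ Y → X ⊓ Y ≤ U) := by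
      intro v hv
      obtain ⟨h1, h2, h3, h4⟩ := image_sup_card _ (k+1) T hT hV hcard hblock v hv
      obtain ⟨U, W, hUr, hWr, hUW⟩ := ih c (by omega) (k+1) _ h1 (by omega) h2 h3
      have hUW' : ∀ X ∈ T, U ≤ X ⊔ F ∙ v ∧ X ⊔ F ∙ v ≤ W := fun X hX =>
        hUW _ (Finset.mem_image_of_mem _ hX)
      have hinf : ∀ X ∈ T, ∀ Y ∈ T, X ≠ Y → U = (X ⊔ F ∙ v) ⊓ (Y ⊔ F ∙ v) := by
        intro X hX Y hY hXY
        apply Submodule.eq_of_le_of_finrank_le (le_inf (hUW' X hX).1 (hUW' Y hY).1)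
        have h5 := Submodule.finrank_sup_add_finrank_inf_eq (X ⊔ F ∙ v) (Y ⊔ F ∙ v)
        rw [h1 _ (Finset.mem_image_of_mem _ hX), h1 _ (Finset.mem_image_of_mem _ hY)] at h5
        have h6 := hbig X hX Y hY hXY
        have h7 : finrank F (X ⊔ Y : Submodule F V) ≤
            finrank F ((X ⊔ F ∙ v) ⊔ (Y ⊔ F ∙ v) : Submodule F V) :=
          Submodule.finrank_mono (sup_le_sup le_sup_left le_sup_left)
        omega
      refine ⟨U, hUr, ?_, fun X hX => (hUW' X hX).1, ?_⟩
      · rw [hinf X0 hX0 Y0 hY0 hXY0]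
        exact ⟨Submodule.mem_sup_right (Submodule.mem_span_singleton_self v),
          Submodule.mem_sup_right (Submodule.mem_span_singleton_self v)⟩
      · intro X hX Y hY hXY
        rw [hinf X hX Y hY hXY]
        exact inf_le_inf le_sup_left le_sup_left
    obtain ⟨v', hv'⟩ := exists_uncovered T (k+1) hT (hcount _ (by omega))
    obtain ⟨U', hU'r, -, -, hU'i⟩ := hU v' hv'
    obtain ⟨v, hv⟩ := exists_uncovered (insert U' T) (k+1)
      (by
        intro X hX
        rcases Finset.mem_insert.1 hX with rfl | hX
        · exact hU'r
        · exact hT X hX)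
      (hcount _ ((Finset.card_insert_le _ _).trans (by omega)))
    have hvU' : v ∉ U' := hv U' (Finset.mem_insert_self _ _)
    have hvT : ∀ X ∈ T, v ∉ X := fun X hX => hv X (Finset.mem_insert_of_mem hX)
    obtain ⟨U, hUr, hvU, hUle, hUi⟩ := hU v hvT
    have hXU : ∀ X ∈ T, finrank F (X ⊓ U : Submodule F V) = k := by
      intro X hX
      have h1 := Submodule.finrank_sup_add_finrank_inf_eq X U
      have h2 : finrank F (X ⊔ U : Submodule F V) ≤ finrank F (X ⊔ F ∙ v : Submodule F V) :=
        Submodule.finrank_mono (sup_le le_sup_left (hUle X hX))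
      have h3 : finrank F (X ⊓ U : Submodule F V) < finrank F U := by
        apply Submodule.finrank_lt_finrank_of_lt
        refine lt_of_le_of_ne inf_le_right (fun h => hvT X hX ?_)
        exact (inf_eq_right.1 h) hvU
      rw [finrank_sup_span _ _ (hvT X hX), hT X hX] at h2
      rw [hT X hX, hUr] at h1
      omega
    have hinj : Set.InjOn (fun X : Submodule F V => X ⊓ U) (T : Set (Submodule F V)) := by
      intro X hX Y hY h
      by_contra hXY
      have h1 := hbig X hX Y hY hXY
      have h2 := Submodule.finrank_sup_add_finrank_inf_eq X Y
      simp only at h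
      have h3 : finrank F (X ⊓ U : Submodule F V) ≤ finrank F (X ⊓ Y : Submodule F V) :=
        Submodule.finrank_mono (le_inf inf_le_left (h ▸ inf_le_left))
      rw [hXU X hX] at h3
      rw [hT X hX, hT Y hY] at h2
      omega
    obtain ⟨Z, hZ, hvZ⟩ := cover_of_inf_le k (T.image (fun X => X ⊓ U)) U U' hUr
      (by
        intro Z hZ
        obtain ⟨X, hX, rfl⟩ := Finset.mem_image.1 hZ
        exact ⟨hXU X hX, inf_le_right⟩)
      (by rw [Finset.card_image_of_injOn hinj, hcard])
      (by
        intro Z hZ Z' hZ' hne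
        obtain ⟨X, hX, rfl⟩ := Finset.mem_image.1 hZ
        obtain ⟨Y, hY, rfl⟩ := Finset.mem_image.1 hZ'
        have hXY : X ≠ Y := by rintro rfl; exact hne rfl
        exact (inf_le_inf inf_le_left inf_le_left).trans (hU'i X hX Y hY hXY))
      v hvU hvU'
    obtain ⟨X, hX, rfl⟩ := Finset.mem_image.1 hZ
    exact hvT X hX hvZ.1

end aux

/-- Main result for projective spaces: let `0 ≤ k < n` and `q` a prime power
(`F = F_q`).  A projective `k`-space of `PG(n,q)` is a `(k+1)`-dimensional
linear subspace of `F_q^{n+1}`.  If `T` is a set of `q+1` projective `k`-spaces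
such that no projective `(n-k-1)`-space (linear dimension `n-k`) is disjoint
from every member of `T`, then there are a `(k-1)`-space `U` and a `(k+1)`-space
`W` with `U ≤ W` such that `T` is the pencil of `k`-spaces `X` with `U ≤ X ≤ W`. -/
theorem stmt4 (n k q : ℕ) (hk : k < n) (F : Type*) [Field F] [Fintype F]
    (hq : Fintype.card F = q)
    (T : Set (Submodule F (Fin (n + 1) → F)))
    (hT : ∀ X ∈ T, Module.finrank F X = k + 1)
    (hcard : T.ncard = q + 1)
    (hblock : ∀ Y : Submodule F (Fin (n + 1) → F), Module.finrank F Y = n - k →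
      ∃ X ∈ T, Y ⊓ X ≠ ⊥) :
    ∃ U W : Submodule F (Fin (n + 1) → F),
      Module.finrank F U = k ∧ Module.finrank F W = k + 2 ∧ U ≤ W ∧
      T = {X : Submodule F (Fin (n + 1) → F) |
            Module.finrank F X = k + 1 ∧ U ≤ X ∧ X ≤ W} := by
  classical
  have hTf : T.Finite := Set.finite_of_ncard_pos (by omega)
  subst hq
  have hcard' : hTf.toFinset.card = Fintype.card F + 1 := by
    rw [← Set.ncard_eq_toFinset_card T hTf]; exact hcard
  have hT' : ∀ X ∈ hTf.toFinset, Module.finrank F X = k + 1 := fun X hX =>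
    hT X (hTf.mem_toFinset.1 hX)
  obtain ⟨U, W, hU, hW, hUW⟩ := main_aux (n - k - 1) k hTf.toFinset hT'
    (by rw [Module.finrank_fin_fun]; omega) hcard' (by
      rintro ⟨Y, hY, hd⟩
      obtain ⟨X, hX, hne⟩ := hblock Y (by omega)
      exact hne (disjoint_iff.1 (hd X (hTf.mem_toFinset.2 hX))))
  have hUW' : ∀ X ∈ T, U ≤ X ∧ X ≤ W := fun X hX => hUW X (hTf.mem_toFinset.2 hX)
  have hULW : U ≤ W := by
    obtain ⟨X, hX⟩ := Set.nonempty_of_ncard_ne_zero (s := T) (by omega)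
    exact (hUW' X hX).1.trans (hUW' X hX).2
  refine ⟨U, W, hU, hW, hULW, ?_⟩
  have key : ∀ X Y : Submodule F (Fin (n + 1) → F), Module.finrank F X = k + 1 →
      Module.finrank F Y = k + 1 → U ≤ X → U ≤ Y → ∀ x ∈ X, x ∈ Y → x ∉ U → X = Y := by
    intro X Y hX hY hUX hUY x hxX hxY hxU
    have h1 : U < X ⊓ Y := lt_of_le_of_ne (le_inf hUX hUY) (fun h => hxU (h ▸ ⟨hxX, hxY⟩))
    have h2 := Submodule.finrank_lt_finrank_of_lt h1
    have h3 : X ⊓ Y = X := Submodule.eq_of_le_of_finrank_le inf_le_left (by omega)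
    have h4 : X ⊓ Y = Y := Submodule.eq_of_le_of_finrank_le inf_le_right (by omega)
    exact h3.symm.trans h4
  ext X
  constructor
  · intro hX
    exact ⟨hT X hX, hUW' X hX⟩
  · rintro ⟨hXr, hUX, hXW⟩
    have hlt : U < X := lt_of_le_of_ne hUX (fun h => by rw [h] at hU; omega)
    obtain ⟨x, hxX, hxU⟩ := SetLike.exists_of_lt hlt
    obtain ⟨Y, hY, hxY⟩ := cover_of_inf_le (k + 1) hTf.toFinset W U hW
      (fun Z hZ => ⟨hT' Z hZ, (hUW Z hZ).2⟩) hcard'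
      (by
        intro Z hZ Z' hZ' hne z hz
        by_contra hzU
        exact hne (key Z Z' (hT' Z hZ) (hT' Z' hZ') (hUW Z hZ).1 (hUW Z' hZ').1 z hz.1 hz.2 hzU))
      x (hXW hxX) hxU
    have hYT := hTf.mem_toFinset.1 hY
    rw [key X Y hXr (hT Y hYT) hUX (hUW' Y hYT).1 x hxX hxY hxU]
    exact hYT
end

section
/- Let Q be a hyperbolic quadric of rank at least 3 in which every line has exactly s+1 points, and let T be a set of s+1 distinct points of Q not all contained in a single line. Then there exists a point of Q non-collinear with every point of T. -/
/-- The standard hyperbolic quadratic form of rank `n` on `F^n × F^n`. -/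
def hypQ {F : Type*} [Field F] {n : ℕ} (v : (Fin n → F) × (Fin n → F)) : F :=
  ∑ i, v.1 i * v.2 i

/-- The bilinear form obtained by polarising `hypQ`. -/
def hypB {F : Type*} [Field F] {n : ℕ} (u v : (Fin n → F) × (Fin n → F)) : F :=
  ∑ i, (u.1 i * v.2 i + u.2 i * v.1 i)

/-- A point of the hyperbolic quadric: a singular `1`-space. -/
def hypPt {F : Type*} [Field F] {n : ℕ}
    (p : Submodule F ((Fin n → F) × (Fin n → F))) : Prop :=
  Module.finrank F p = 1 ∧ ∀ v ∈ p, hypQ v = 0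

/-- Collinearity of points on the quadric: the polar form vanishes. -/
def hypCollin {F : Type*} [Field F] {n : ℕ}
    (p q : Submodule F ((Fin n → F) × (Fin n → F))) : Prop :=
  ∀ u ∈ p, ∀ v ∈ q, hypB u v = 0

section HypHelpers
variable {F : Type*} [Field F] {n : ℕ}

local notation "VV" => ((Fin n → F) × (Fin n → F))

lemma hB_add_left (u v w : VV) : hypB (u + v) w = hypB u w + hypB v w := by
  simp only [hypB, ← Finset.sum_add_distrib]
  refine Finset.sum_congr rfl fun i _ => ?_
  simp; ring

lemma hB_smul_left (c : F) (u w : VV) : hypB (c • u) w = c * hypB u w := by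
  simp only [hypB, Finset.mul_sum]
  refine Finset.sum_congr rfl fun i _ => ?_
  simp; ring

lemma hB_symm (u v : VV) : hypB u v = hypB v u := by
  simp only [hypB]
  refine Finset.sum_congr rfl fun i _ => ?_
  ring

lemma hB_add_right (u v w : VV) : hypB w (u + v) = hypB w u + hypB w v := by
  rw [hB_symm, hB_add_left, hB_symm u, hB_symm v]

lemma hB_smul_right (c : F) (u w : VV) : hypB w (c • u) = c * hypB w u := by
  rw [hB_symm, hB_smul_left, hB_symm u]

lemma hQ_add (u v : VV) : hypQ (u + v) = hypQ u + hypQ v + hypB u v := by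
  simp only [hypB, hypQ, ← Finset.sum_add_distrib]
  refine Finset.sum_congr rfl fun i _ => ?_
  simp; ring

lemma hQ_smul (c : F) (u : VV) : hypQ (c • u) = c ^ 2 * hypQ u := by
  simp only [hypQ, Finset.mul_sum]
  refine Finset.sum_congr rfl fun i _ => ?_
  simp; ring

lemma hB_self (u : VV) (h : hypQ u = 0) : hypB u u = 0 := by
  have : hypB u u = 2 * hypQ u := by
    simp only [hypB, hypQ, Finset.mul_sum]
    refine Finset.sum_congr rfl fun i _ => ?_
    ring
  rw [this, h, mul_zero]

/-- The polar form as a bilinear form. -/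
def hBf : LinearMap.BilinForm F VV :=
  LinearMap.mk₂ F hypB hB_add_left hB_smul_left
    (fun w u v => hB_add_right u v w) (fun c w u => hB_smul_right c u w)

@[simp] lemma hBf_apply (u v : VV) : (hBf u) v = hypB u v := rfl

lemma hBf_refl : (hBf : LinearMap.BilinForm F VV).IsRefl := by
  intro u v h
  rw [hBf_apply] at *
  rw [hB_symm, h]

lemma hB_nondeg (u : VV) (h : ∀ v, hypB u v = 0) : u = 0 := by
  ext i
  · have := h (0, Pi.single i 1)
    simpa [hypB, Pi.single_apply] using this
  · have := h (Pi.single i 1, 0)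
    simpa [hypB, Pi.single_apply] using this

lemma hBf_nondeg : (hBf : LinearMap.BilinForm F VV).Nondegenerate := by
  refine ⟨fun u hu => hB_nondeg u hu, fun u hu => hB_nondeg u fun v => ?_⟩
  rw [hB_symm]
  exact hu v

lemma exists_perp (P : Submodule F VV) (t : VV) (ht : t ∉ P) :
    ∃ y, (∀ p ∈ P, hypB y p = 0) ∧ hypB y t ≠ 0 := by
  by_contra! hc
  apply ht
  rw [← LinearMap.BilinForm.orthogonal_orthogonal hBf_nondeg hBf_refl P]
  rw [LinearMap.BilinForm.mem_orthogonal_iff]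
  intro y hy
  rw [LinearMap.BilinForm.mem_orthogonal_iff] at hy
  exact hc y fun p hp => by rw [hB_symm]; exact hy p hp

/-- The standard maximal totally singular subspace. -/
def hE : Submodule F VV := LinearMap.range (LinearMap.inl F (Fin n → F) (Fin n → F))

lemma mem_hE (v : VV) : v ∈ (hE : Submodule F VV) ↔ v.2 = 0 := by
  constructor
  · rintro ⟨a, rfl⟩; rfl
  · intro h; exact ⟨v.1, by ext <;> simp [h]⟩

lemma finrank_hE : Module.finrank F (hE : Submodule F VV) = n := by
  unfold hE
  rw [LinearMap.finrank_range_of_inj LinearMap.inl_injective]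
  simp

lemma hQ_hE (v : VV) (h : v ∈ (hE : Submodule F VV)) : hypQ v = 0 := by
  rw [mem_hE] at h
  simp [hypQ, h]

lemma hE_perp (v : VV) (h : ∀ e ∈ (hE : Submodule F VV), hypB e v = 0) :
    v ∈ (hE : Submodule F VV) := by
  rw [mem_hE]
  ext i
  have := h (Pi.single i 1, 0) (by rw [mem_hE])
  simpa [hypB, Pi.single_apply] using this

/-- A small totally singular subspace extends. -/
lemma exists_ext (U : Submodule F VV)
    (hd : Module.finrank F U < n) :
    ∃ k, hypQ k = 0 ∧ k ∉ U ∧ ∀ u ∈ U, hypB k u = 0 := by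
  by_contra! hc
  have h1 := LinearMap.BilinForm.finrank_orthogonal hBf_nondeg (U ⊔ hE)
  have h2 := Submodule.finrank_sup_add_finrank_inf_eq U (hE : Submodule F VV)
  have h3 : (hBf : LinearMap.BilinForm F VV).orthogonal (U ⊔ hE) ≤ U ⊓ hE := by
    intro k hk
    rw [LinearMap.BilinForm.mem_orthogonal_iff] at hk
    have hkE : k ∈ (hE : Submodule F VV) :=
      hE_perp k fun e he => hk e (Submodule.mem_sup_right he)
    refine ⟨?_, hkE⟩
    by_contra hkU
    obtain ⟨u, hu, hne⟩ := hc k (hQ_hE k hkE) hkU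
    exact hne (by rw [hB_symm]; exact hk u (Submodule.mem_sup_left hu))
  have h4 := Submodule.finrank_mono h3
  have h5 : Module.finrank F VV = n + n := by simp
  have h6 : Module.finrank F ↥(U ⊔ (hE : Submodule F VV)) ≤ Module.finrank F VV :=
    Submodule.finrank_le _
  rw [finrank_hE] at h2
  omega

/-- Choosing a point on the line through `r` and `x`. -/
lemma line_lemma [Fintype F] [DecidableEq F] (S : Finset VV) (r x : VV)
    (h : ∀ s ∈ S, hypB x s ≠ 0 ∨ hypB r s ≠ 0)
    (hc : ((S.filter fun s => hypB r s ≠ 0).image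
      fun s => - hypB x s / hypB r s).card < Fintype.card F) :
    ∃ l : F, ∀ s ∈ S, hypB (x + l • r) s ≠ 0 := by
  obtain ⟨l, hl⟩ := Finset.exists_mem_notMem_of_card_lt_card
    (t := (Finset.univ : Finset F)) hc
  refine ⟨l, fun s hs h0 => ?_⟩
  rw [hB_add_left, hB_smul_left] at h0
  by_cases hr : hypB r s = 0
  · rcases h s hs with h' | h'
    · apply h'; simpa [hr] using h0
    · exact h' hr
  · apply hl.2
    rw [Finset.mem_image]
    refine ⟨s, Finset.mem_filter.2 ⟨hs, hr⟩, ?_⟩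
    rw [div_eq_iff hr]
    linear_combination -h0

lemma hQ_line (r x : VV) (hr : hypQ r = 0) (hx : hypQ x = 0) (h : hypB x r = 0) (l : F) :
    hypQ (x + l • r) = 0 := by
  rw [hQ_add, hQ_smul, hB_smul_right, hr, hx, h]; ring

lemma span2_perp (r t : VV) (hr : hypQ r = 0) (ht : hypQ t = 0) (h : hypB r t = 0) :
    ∀ u ∈ Submodule.span F {r, t}, ∀ v ∈ Submodule.span F {r, t}, hypB u v = 0 := by
  intro u hu v hv
  obtain ⟨a, b, rfl⟩ := Submodule.mem_span_pair.1 hu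
  obtain ⟨c, d, rfl⟩ := Submodule.mem_span_pair.1 hv
  simp only [hB_add_left, hB_add_right, hB_smul_left, hB_smul_right, hB_self r hr,
    hB_self t ht, h, hB_symm t r]; ring

lemma ext1 (hn : 3 ≤ n) (r : VV) :
    ∃ k, hypQ k = 0 ∧ k ∉ Submodule.span F {r} ∧ hypB k r = 0 := by
  obtain ⟨k, h1, h2, h3⟩ := exists_ext (Submodule.span F {r})
    (by have := finrank_span_finset_le_card (R := F) ({r} : Finset VV)
        rw [Set.finrank, Finset.coe_singleton, Finset.card_singleton] at this; omega)
  exact ⟨k, h1, h2, h3 r (Submodule.mem_span_singleton_self r)⟩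

lemma ext2 (hn : 3 ≤ n) (r t : VV) :
    ∃ k, hypQ k = 0 ∧ k ∉ Submodule.span F {r, t} ∧ hypB k r = 0 ∧ hypB k t = 0 := by
  classical
  obtain ⟨k, h1, h2, h3⟩ := exists_ext (Submodule.span F {r, t})
    (by have := finrank_span_finset_le_card (R := F) ({r, t} : Finset VV)
        have h2 := Finset.card_le_two (a := r) (b := t)
        rw [Set.finrank, Finset.coe_pair] at this; omega)
  exact ⟨k, h1, h2, h3 r (Submodule.subset_span (by simp)),
    h3 t (Submodule.subset_span (by simp))⟩

/-- If `r ⟂ t` are distinct points, some point of `r^⟂` is not in `t^⟂`. -/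
lemma exists_sep (r t : VV) (ht : hypQ t = 0) (h : hypB r t = 0)
    (hne : t ∉ Submodule.span F {r}) :
    ∃ w, hypQ w = 0 ∧ hypB w r = 0 ∧ hypB w t ≠ 0 := by
  obtain ⟨y, hy, hyt⟩ := exists_perp _ t hne
  have hyr := hy r (Submodule.mem_span_singleton_self r)
  refine ⟨y + (-hypQ y / hypB y t) • t, ?_, ?_, ?_⟩
  · rw [hQ_add, hQ_smul, hB_smul_right, ht]; field_simp; ring
  · rw [hB_add_left, hB_smul_left, hB_symm t r, h, hyr]; ring
  · rw [hB_add_left, hB_smul_left, hB_self t ht]; simpa using hyt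

/-- Any at most `q` points have a common opposite point. -/
lemma exists_opp [Fintype F] (hn : 3 ≤ n) (S : Finset VV)
    (hQ : ∀ s ∈ S, hypQ s = 0) (h0 : ∀ s ∈ S, s ≠ 0) (hc : S.card ≤ Fintype.card F) :
    ∃ r, hypQ r = 0 ∧ r ≠ 0 ∧ ∀ s ∈ S, hypB r s ≠ 0 := by
  classical
  induction S using Finset.induction_on with
  | empty =>
    obtain ⟨k, h1, h2, -⟩ := ext1 (F := F) hn 0
    exact ⟨k, h1, fun h => h2 (by rw [h]; exact Submodule.zero_mem _), by simp⟩
  | insert t S htS ih =>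
    rw [Finset.card_insert_of_notMem htS] at hc
    have hQt := hQ t (Finset.mem_insert_self _ _)
    have hcount : ∀ r x : VV, ((S.filter fun s => hypB r s ≠ 0).image
        fun s => - hypB x s / hypB r s).card < Fintype.card F := fun r x =>
      lt_of_le_of_lt (Finset.card_image_le.trans (Finset.card_filter_le _ _)) (by omega)
    obtain ⟨r, hr, hr0, hrS⟩ := ih (fun s hs => hQ s (Finset.mem_insert_of_mem hs))
      (fun s hs => h0 s (Finset.mem_insert_of_mem hs)) (by omega)
    -- reduce to r not proportional to t
    obtain ⟨r, hr, hr0, hrS, hrt⟩ : ∃ r : VV, hypQ r = 0 ∧ r ≠ 0 ∧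
        (∀ s ∈ S, hypB r s ≠ 0) ∧ t ∉ Submodule.span F {r} := by
      by_cases hrt : t ∈ Submodule.span F {r}
      · obtain ⟨k, hk, hkr, hkp⟩ := ext1 hn r
        obtain ⟨l, hl⟩ := line_lemma S r k (fun s hs => Or.inr (hrS s hs)) (hcount r k)
        have hnot : k + l • r ∉ Submodule.span F {r} := fun hm => hkr (by
          have := Submodule.sub_mem _ hm
            (Submodule.smul_mem _ l (Submodule.mem_span_singleton_self r))
          simpa using this)
        refine ⟨k + l • r, hQ_line r k hr hk hkp l, ?_, hl, ?_⟩
        · intro h; exact hnot (h ▸ Submodule.zero_mem _)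
        · intro hm
          obtain ⟨c, hc⟩ := Submodule.mem_span_singleton.1 hm
          have hc0 : c ≠ 0 := by
            rintro rfl
            exact h0 t (Finset.mem_insert_self _ _) (by rw [← hc, zero_smul])
          apply hnot
          have : k + l • r = c⁻¹ • t := by rw [← hc, smul_smul, inv_mul_cancel₀ hc0, one_smul]
          rw [this]
          exact Submodule.smul_mem _ _ hrt
      · exact ⟨r, hr, hr0, hrS, hrt⟩
    by_cases hB : hypB r t = 0
    · obtain ⟨w, hw, hwr, hwt⟩ := exists_sep r t hQt hB hrt
      obtain ⟨l, hl⟩ := line_lemma S r w (fun s hs => Or.inr (hrS s hs)) (hcount r w)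
      have hlt : hypB (w + l • r) t ≠ 0 := by
        rw [hB_add_left, hB_smul_left, hB]; simpa using hwt
      refine ⟨w + l • r, hQ_line r w hr hw hwr l, ?_, ?_⟩
      · intro h; rw [h] at hlt; exact hlt (by simp [hypB])
      · intro s hs
        rcases Finset.mem_insert.1 hs with rfl | hs
        · exact hlt
        · exact hl s hs
    · refine ⟨r, hr, hr0, fun s hs => ?_⟩
      rcases Finset.mem_insert.1 hs with rfl | hs
      · exact hB
      · exact hrS s hs

/-- A singular vector orthogonal to three points, the first opposite the second. -/
lemma exists_triple (hn : 3 ≤ n) (r t u : VV) (hr : hypQ r = 0) (h : hypB r t ≠ 0) :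
    ∃ x, hypQ x = 0 ∧ x ≠ 0 ∧ hypB x r = 0 ∧ hypB x t = 0 ∧ hypB x u = 0 := by
  obtain ⟨k, hk, hkr, hkp⟩ := ext1 hn r
  have hrr := hB_self r hr
  -- make k orthogonal to t
  obtain ⟨k, hk, hk0, hkp, hkt⟩ : ∃ k : VV, hypQ k = 0 ∧ k ≠ 0 ∧
      hypB k r = 0 ∧ hypB k t = 0 := by
    refine ⟨k + (-hypB k t / hypB r t) • r, hQ_line r k hr hk hkp _, ?_, ?_, ?_⟩
    · intro h0
      apply hkr
      rw [eq_neg_of_add_eq_zero_left h0]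
      exact Submodule.neg_mem _ (Submodule.smul_mem _ _ (Submodule.mem_span_singleton_self r))
    · rw [hB_add_left, hB_smul_left, hrr, hkp]; ring
    · rw [hB_add_left, hB_smul_left]; field_simp; ring
  obtain ⟨m, hm, hmU, hmr, hmk⟩ := ext2 hn r k
  obtain ⟨m, hm, hmk0, hmr, hmk, hmt⟩ : ∃ m : VV, hypQ m = 0 ∧ m ∉ Submodule.span F {r, k} ∧
      hypB m r = 0 ∧ hypB m k = 0 ∧ hypB m t = 0 := by
    refine ⟨m + (-hypB m t / hypB r t) • r, hQ_line r m hr hm hmr _, ?_, ?_, ?_, ?_⟩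
    · intro h0
      apply hmU
      have := Submodule.sub_mem _ h0 (Submodule.smul_mem _ (-hypB m t / hypB r t)
        (Submodule.subset_span (show r ∈ ({r, k} : Set VV) by simp)))
      simpa using this
    · rw [hB_add_left, hB_smul_left, hrr, hmr]; ring
    · rw [hB_add_left, hB_smul_left, hB_symm r k, hkp, hmk]; ring
    · rw [hB_add_left, hB_smul_left]; field_simp; ring
  by_cases hku : hypB k u = 0
  · exact ⟨k, hk, hk0, hkp, hkt, hku⟩
  · refine ⟨m + (-hypB m u / hypB k u) • k, hQ_line k m hk hm hmk _, ?_, ?_, ?_, ?_⟩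
    · intro h0
      apply hmk0
      rw [eq_neg_of_add_eq_zero_left h0]
      exact Submodule.neg_mem _ (Submodule.smul_mem _ _ (Submodule.subset_span (by simp)))
    · rw [hB_add_left, hB_smul_left, hmr, hkp]; ring
    · rw [hB_add_left, hB_smul_left, hmt, hkt]; ring
    · rw [hB_add_left, hB_smul_left]; field_simp; ring

lemma mem_span3 (x r t u : VV) : x ∈ Submodule.span F {r, t, u} ↔
    ∃ a b c : F, x = a • r + b • t + c • u := by
  rw [Submodule.mem_span_triple]
  constructor
  · rintro ⟨a, b, c, h⟩; exact ⟨a, b, c, h.symm⟩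
  · rintro ⟨a, b, c, h⟩; exact ⟨a, b, c, h.symm⟩

/-- The key geometric lemma. -/
lemma mem_of_perp (hn : 3 ≤ n) (r t t1 t2 : VV) (hr : hypQ r = 0) (ht : hypQ t = 0)
    (hrt : hypB r t = 0) (h1 : hypB r t1 = 1) (h2 : hypB r t2 = 1)
    (hx : ∀ x, hypQ x = 0 → hypB x r = 0 → hypB x t1 = 0 → hypB x t2 = 0 → hypB x t = 0) :
    t ∈ Submodule.span F {r, t1, t2} := by
  by_contra hP
  have hrr := hB_self r hr
  have htt := hB_self t ht
  -- it suffices to find k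
  suffices hk : ∃ k : VV, hypQ k = 0 ∧ hypB k r = 0 ∧ hypB k t1 = 0 ∧ hypB k t2 = 0 ∧
      hypB k t = 0 ∧ k ∉ Submodule.span F {r, t1, t2} by
    obtain ⟨k, hk, hkr, hk1, hk2, hkt, hkP⟩ := hk
    obtain ⟨y, hyP, hyt, hyk⟩ : ∃ y : VV, (∀ p ∈ Submodule.span F {r, t1, t2}, hypB y p = 0) ∧
        hypB y t ≠ 0 ∧ hypB y k ≠ 0 := by
      obtain ⟨y, hy, hyt⟩ := exists_perp _ t hP
      obtain ⟨z, hz, hzk⟩ := exists_perp _ k hkP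
      by_cases hyk : hypB y k = 0
      · by_cases hzt : hypB z t = 0
        · refine ⟨y + z, fun p hp => ?_, ?_, ?_⟩
          · rw [hB_add_left, hy p hp, hz p hp, add_zero]
          · rw [hB_add_left, hzt, add_zero]; exact hyt
          · rw [hB_add_left, hyk, zero_add]; exact hzk
        · exact ⟨z, hz, hzt, hzk⟩
      · exact ⟨y, hy, hyt, hyk⟩
    have hyr := hyP r (Submodule.subset_span (by simp))
    have hy1 := hyP t1 (Submodule.subset_span (by simp))
    have hy2 := hyP t2 (Submodule.subset_span (by simp))
    have := hx (y + (-hypQ y / hypB y k) • k) ?_ ?_ ?_ ?_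
    · rw [hB_add_left, hB_smul_left, hkt] at this
      apply hyt; simpa using this
    · rw [hQ_add, hQ_smul, hB_smul_right, hk]; field_simp; ring
    · rw [hB_add_left, hB_smul_left, hyr, hkr]; ring
    · rw [hB_add_left, hB_smul_left, hy1, hk1]; ring
    · rw [hB_add_left, hB_smul_left, hy2, hk2]; ring
  by_cases hc : hypB t t1 = hypB t t2
  · refine ⟨t + (-hypB t t1) • r, hQ_line r t hr ht (by rw [hB_symm, hrt]) _, ?_, ?_, ?_, ?_, ?_⟩
    · rw [hB_add_left, hB_smul_left, hrr, hB_symm t r, hrt]; ring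
    · rw [hB_add_left, hB_smul_left, h1]; ring
    · rw [hB_add_left, hB_smul_left, h2, hc]; ring
    · rw [hB_add_left, hB_smul_left, hrt, htt]; ring
    · intro h0
      apply hP
      have := Submodule.sub_mem _ h0 (Submodule.smul_mem _ (-hypB t t1)
        (Submodule.subset_span (show r ∈ ({r, t1, t2} : Set VV) by simp)))
      simpa using this
  · have hc' : hypB t t1 - hypB t t2 ≠ 0 := sub_ne_zero.2 hc
    obtain ⟨k, hk, hkU, hkr, hkt⟩ := ext2 hn r t
    obtain ⟨b, hb⟩ : ∃ b : F, b * (hypB t t1 - hypB t t2) = hypB k t2 - hypB k t1 :=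
      ⟨(hypB k t2 - hypB k t1) / (hypB t t1 - hypB t t2), div_mul_cancel₀ _ hc'⟩
    obtain ⟨a, ha⟩ : ∃ a : F, a = - hypB k t1 - b * hypB t t1 := ⟨_, rfl⟩
    have htr : hypB t r = 0 := by rw [hB_symm, hrt]
    have hk1' : hypB (k + b • t + a • r) t1 = 0 := by
      simp only [hB_add_left, hB_smul_left, h1, ha]; ring
    have hkr' : hypB (k + b • t + a • r) r = 0 := by
      simp only [hB_add_left, hB_smul_left, hkr, htr, hrr]; ring
    have hkt' : hypB (k + b • t + a • r) t = 0 := by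
      simp only [hB_add_left, hB_smul_left, hkt, hrt, htt]; ring
    have hkne : k + b • t + a • r ≠ 0 := by
      intro h0
      apply hkU
      rw [Submodule.mem_span_pair]
      refine ⟨-a, -b, ?_⟩
      have : k = -(b • t) - a • r := by
        rw [eq_sub_iff_add_eq, ← sub_eq_zero, ← h0]; abel
      rw [this, neg_smul, neg_smul]; abel
    refine ⟨k + b • t + a • r, ?_, hkr', hk1', ?_, hkt', ?_⟩
    · refine hQ_line _ _ hr (hQ_line _ _ ht hk hkt b) ?_ a
      rw [hB_add_left, hB_smul_left, hkr, htr]; ring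
    · simp only [hB_add_left, hB_smul_left, h2, ha]; linear_combination -hb
    · rw [mem_span3]
      rintro ⟨x, y, z, he⟩
      rw [he] at hkr' hkt' hk1' hkne
      simp only [hB_add_left, hB_smul_left, hrr, hrt, hB_symm t1 r, hB_symm t2 r, h1, h2]
        at hkr' hkt'
      rw [hB_symm t1 t, hB_symm t2 t] at hkt'
      have hz : z = -y := by linear_combination hkr'
      subst hz
      have hy : y = 0 := by
        have : y * (hypB t t1 - hypB t t2) = 0 := by linear_combination hkt'
        exact (mul_eq_zero.1 this).resolve_right hc'
      subst hy
      simp [hB_smul_left, h1] at hk1'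
      apply hkne
      simp [hk1']

lemma key (hn : 3 ≤ n) (r t t1 t2 : VV) (hr : hypQ r = 0) (ht : hypQ t = 0)
    (hq1 : hypQ t1 = 0) (hq2 : hypQ t2 = 0) (hne : t ∉ Submodule.span F {r})
    (hrt : hypB r t = 0) (h1 : hypB r t1 ≠ 0) (h2 : hypB r t2 ≠ 0)
    (hx : ∀ x, hypQ x = 0 → hypB x r = 0 → hypB x t1 = 0 → hypB x t2 = 0 → hypB x t = 0) :
    hypB t1 t2 = 0 ∧ ∃ a b c : F, t = a • r + b • t1 + c • t2 := by
  have hm := mem_of_perp hn r t ((hypB r t1)⁻¹ • t1) ((hypB r t2)⁻¹ • t2) hr ht hrt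
    (by rw [hB_smul_right, inv_mul_cancel₀ h1]) (by rw [hB_smul_right, inv_mul_cancel₀ h2])
    (fun x hxq hxr hx1 hx2 => by
      rw [hB_smul_right] at hx1 hx2
      exact hx x hxq hxr ((mul_eq_zero.1 hx1).resolve_left (inv_ne_zero h1))
        ((mul_eq_zero.1 hx2).resolve_left (inv_ne_zero h2)))
  obtain ⟨a, b, c, he⟩ := (mem_span3 _ _ _ _).1 hm
  rw [smul_smul, smul_smul] at he
  generalize b * (hypB r t1)⁻¹ = b at he
  generalize c * (hypB r t2)⁻¹ = c at he
  refine ⟨?_, a, b, c, he⟩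
  have e1 : b * hypB r t1 + c * hypB r t2 = 0 := by
    have := hrt
    rw [he] at this
    simpa only [hB_add_right, hB_smul_right, hB_self r hr, mul_zero, zero_add] using this
  have e2 : b * c * hypB t1 t2 = 0 := by
    have := ht
    rw [he] at this
    simp only [hQ_add, hB_add_left, hB_smul_left, hB_smul_right, hQ_smul, hr, hq1, hq2] at this
    linear_combination this - a * e1
  rcases mul_eq_zero.1 e2 with h | h
  · exfalso
    have hb : b = 0 ∧ c = 0 := by
      rcases mul_eq_zero.1 h with h | h
      · subst h
        exact ⟨rfl, by simpa [h2] using e1⟩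
      · subst h
        exact ⟨by simpa [h1] using e1, rfl⟩
    apply hne
    rw [he, hb.1, hb.2]
    simpa using Submodule.smul_mem _ a (Submodule.mem_span_singleton_self r)
  · exact h

lemma two_same [Fintype F] [DecidableEq F] (S : Finset VV) (hc : S.card ≤ Fintype.card F)
    (r x t1 t2 : VV) (m1 : t1 ∈ S) (m2 : t2 ∈ S) (hne : t1 ≠ t2)
    (h1 : hypB x t1 = 0) (h2 : hypB x t2 = 0) :
    ((S.filter fun s => hypB r s ≠ 0).image
      fun s => - hypB x s / hypB r s).card < Fintype.card F := by
  classical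
  have hsub : ((S.filter fun s => hypB r s ≠ 0).image fun s => - hypB x s / hypB r s) ⊆
      (S.erase t1).image fun s => - hypB x s / hypB r s := by
    intro l hl
    obtain ⟨s, hs, rfl⟩ := Finset.mem_image.1 hl
    have hs := (Finset.mem_filter.1 hs).1
    by_cases hst : s = t1
    · subst hst
      exact Finset.mem_image.2 ⟨t2, Finset.mem_erase.2 ⟨hne.symm, m2⟩, by simp [h1, h2]⟩
    · exact Finset.mem_image.2 ⟨s, Finset.mem_erase.2 ⟨hst, hs⟩, rfl⟩
  have := Finset.card_le_card hsub
  have h3 := Finset.card_image_le (s := S.erase t1) (f := fun s => - hypB x s / hypB r s)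
  have h4 := Finset.card_erase_lt_of_mem m1
  omega

lemma step [Fintype F] (hn : 3 ≤ n) (S : Finset VV) (hc : S.card = Fintype.card F + 1)
    (hQ : ∀ s ∈ S, hypQ s = 0) (h0 : ∀ s ∈ S, s ≠ 0)
    (hno : ∀ r, hypQ r = 0 → ∃ s ∈ S, hypB r s = 0)
    (t t1 t2 : VV) (mt : t ∈ S) (m1 : t1 ∈ S) (m2 : t2 ∈ S)
    (n1 : t1 ≠ t) (n2 : t2 ≠ t) (n12 : t1 ≠ t2) :
    hypB t1 t2 = 0 ∧ ∃ r : VV, hypB r t1 ≠ 0 ∧ ∃ a b c : F, t = a • r + b • t1 + c • t2 := by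
  classical
  have hcS : (S.erase t).card ≤ Fintype.card F := by
    rw [Finset.card_erase_of_mem mt]; omega
  have e1 : t1 ∈ S.erase t := Finset.mem_erase.2 ⟨n1, m1⟩
  have e2 : t2 ∈ S.erase t := Finset.mem_erase.2 ⟨n2, m2⟩
  obtain ⟨r, hr, hr0, hrS⟩ := exists_opp hn (S.erase t)
    (fun s hs => hQ s (Finset.mem_of_mem_erase hs))
    (fun s hs => h0 s (Finset.mem_of_mem_erase hs)) hcS
  obtain ⟨r, hr, hrS, hrt⟩ : ∃ r : VV, hypQ r = 0 ∧
      (∀ s ∈ S.erase t, hypB r s ≠ 0) ∧ t ∉ Submodule.span F {r} := by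
    by_cases hrt : t ∈ Submodule.span F {r}
    · obtain ⟨x, hx, hx0, hxr, hx1, hx2⟩ := exists_triple hn r t1 t2 hr (hrS t1 e1)
      obtain ⟨l, hl⟩ := line_lemma (S.erase t) r x (fun s hs => Or.inr (hrS s hs))
        (two_same _ hcS r x t1 t2 e1 e2 n12 hx1 hx2)
      refine ⟨x + l • r, hQ_line r x hr hx hxr l, hl, fun hm => ?_⟩
      obtain ⟨c, hct⟩ := Submodule.mem_span_singleton.1 hm
      obtain ⟨d, hdt⟩ := Submodule.mem_span_singleton.1 hrt
      have hc0 : c ≠ 0 := by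
        rintro rfl
        exact h0 t mt (by rw [← hct, zero_smul])
      have hxe : x = (c⁻¹ * d - l) • r := by
        rw [sub_smul, mul_smul, hdt, ← hct, smul_smul, inv_mul_cancel₀ hc0, one_smul]
        abel
      rw [hxe, hB_smul_left] at hx1
      rw [(mul_eq_zero.1 hx1).resolve_right (hrS t1 e1), zero_smul] at hxe
      exact hx0 hxe
    · exact ⟨r, hr, hrS, hrt⟩
  have hB : hypB r t = 0 := by
    obtain ⟨s, hs, hs0⟩ := hno r hr
    by_cases hst : s = t
    · rwa [hst] at hs0
    · exact absurd hs0 (hrS s (Finset.mem_erase.2 ⟨hst, hs⟩))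
  obtain ⟨k1, a, b, c, k2⟩ := key hn r t t1 t2 hr (hQ t mt) (hQ t1 m1) (hQ t2 m2) hrt hB
    (hrS t1 e1) (hrS t2 e2) (fun x hx hxr hx1 hx2 => by
      by_contra hxt
      obtain ⟨l, hl⟩ := line_lemma (S.erase t) r x (fun s hs => Or.inr (hrS s hs))
        (two_same _ hcS r x t1 t2 e1 e2 n12 hx1 hx2)
      obtain ⟨s, hs, hs0⟩ := hno _ (hQ_line r x hr hx hxr l)
      by_cases hst : s = t
      · rw [hst, hB_add_left, hB_smul_left, hB] at hs0
        apply hxt; simpa using hs0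
      · exact hl s (Finset.mem_erase.2 ⟨hst, hs⟩) hs0)
  exact ⟨k1, r, hrS t1 e1, a, b, c, k2⟩

lemma vec_main [Fintype F] (hn : 3 ≤ n) (S : Finset VV) (hc : S.card = Fintype.card F + 1)
    (hQ : ∀ s ∈ S, hypQ s = 0) (h0 : ∀ s ∈ S, s ≠ 0)
    (hind : ∀ s ∈ S, ∀ t ∈ S, s ≠ t → t ∉ Submodule.span F {s})
    (hno : ∀ r, hypQ r = 0 → ∃ s ∈ S, hypB r s = 0) :
    ∃ L : Submodule F VV, Module.finrank F L = 2 ∧ (∀ v ∈ L, hypQ v = 0) ∧ ∀ s ∈ S, s ∈ L := by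
  classical
  have hq : 1 < Fintype.card F := Fintype.one_lt_card
  have hpair : ∀ t1 ∈ S, ∀ t2 ∈ S, t1 ≠ t2 → hypB t1 t2 = 0 := by
    intro t1 m1 t2 m2 hne
    have : ({t1, t2} : Finset VV).card < S.card := by
      have := Finset.card_le_two (a := t1) (b := t2)
      omega
    obtain ⟨t, mt, ht⟩ := Finset.exists_mem_notMem_of_card_lt_card this
    simp only [Finset.mem_insert, Finset.mem_singleton, not_or] at ht
    exact (step hn S hc hQ h0 hno t t1 t2 mt m1 m2 (Ne.symm ht.1) (Ne.symm ht.2) hne).1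
  obtain ⟨t1, m1, t2, m2, hne⟩ := Finset.one_lt_card.1 (show 1 < S.card by omega)
  refine ⟨Submodule.span F {t1, t2}, ?_, ?_, ?_⟩
  · have hli : LinearIndependent F ![t1, t2] := by
      rw [LinearIndependent.pair_iff' (h0 t1 m1)]
      intro a ha
      exact hind t1 m1 t2 m2 hne (Submodule.mem_span_singleton.2 ⟨a, ha⟩)
    have := finrank_span_eq_card hli
    rw [Matrix.range_cons, Matrix.range_cons, Matrix.range_empty, Set.union_empty,
      Set.singleton_union] at this
    simpa using this
  · intro v hv
    obtain ⟨a, b, rfl⟩ := Submodule.mem_span_pair.1 hv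
    rw [hQ_add, hQ_smul, hQ_smul, hB_smul_left, hB_smul_right, hQ t1 m1, hQ t2 m2,
      hpair t1 m1 t2 m2 hne]
    ring
  · intro t mt
    by_cases n1 : t1 = t
    · subst n1; exact Submodule.subset_span (by simp)
    by_cases n2 : t2 = t
    · subst n2; exact Submodule.subset_span (by simp)
    obtain ⟨-, r, hr, a, b, c, he⟩ := step hn S hc hQ h0 hno t t1 t2 mt m1 m2 n1 n2 hne
    have h3 := hpair t mt t1 m1 (Ne.symm n1)
    rw [he] at h3
    simp only [hB_add_left, hB_smul_left, hB_self t1 (hQ t1 m1),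
      hpair t2 m2 t1 m1 (Ne.symm hne)] at h3
    have ha : a = 0 := by simpa [hr] using h3
    rw [Submodule.mem_span_pair]
    exact ⟨b, c, by rw [he, ha]; simp⟩

end HypHelpers

/-- On a hyperbolic quadric of rank `n ≥ 3` whose lines have exactly `s+1`
points, for every set `T` of `s+1` distinct points not all on one line there is
a point of the quadric non-collinear with every point of `T`. -/
theorem stmt10 (n s : ℕ) (hn : 3 ≤ n) (F : Type*) [Field F] [Fintype F]
    (hs : Fintype.card F = s)
    (T : Set (Submodule F ((Fin n → F) × (Fin n → F))))
    (hT : ∀ p ∈ T, hypPt p)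
    (hcard : T.ncard = s + 1)
    (hnotline : ¬ ∃ L : Submodule F ((Fin n → F) × (Fin n → F)),
      Module.finrank F L = 2 ∧ (∀ v ∈ L, hypQ v = 0) ∧ ∀ p ∈ T, p ≤ L) :
    ∃ r : Submodule F ((Fin n → F) × (Fin n → F)),
      hypPt r ∧ ∀ p ∈ T, ¬ hypCollin r p := by
  classical
  have hfin : T.Finite := Set.finite_of_ncard_ne_zero (by omega)
  have hgen : ∀ p : Submodule F ((Fin n → F) × (Fin n → F)), ∃ v, p ∈ T →
      v ≠ 0 ∧ p = Submodule.span F {v} := by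
    intro p
    by_cases hp : p ∈ T
    · obtain ⟨v, hv, hspan⟩ := finrank_eq_one_iff'.1 (hT p hp).1
      refine ⟨v, fun _ => ⟨fun h => hv (Subtype.ext h), ?_⟩⟩
      apply le_antisymm
      · intro w hw
        obtain ⟨c, hc⟩ := hspan ⟨w, hw⟩
        exact Submodule.mem_span_singleton.2 ⟨c, congrArg Subtype.val hc⟩
      · rw [Submodule.span_singleton_le_iff_mem]
        exact v.2
    · exact ⟨0, fun h => absurd h hp⟩
  choose g hg using hgen
  have hgm : ∀ p ∈ T, g p ∈ p := by
    intro p hp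
    have h := Submodule.mem_span_singleton_self (R := F) (g p)
    rwa [← (hg p hp).2] at h
  have hinj : Set.InjOn g T := by
    intro p hp q hq h
    rw [(hg p hp).2, (hg q hq).2, h]
  by_contra! hno
  apply hnotline
  obtain ⟨L, hL1, hL2, hL3⟩ := vec_main hn (hfin.toFinset.image g) (by
      rw [Finset.card_image_of_injOn (by simpa using hinj), ← Set.ncard_eq_toFinset_card T hfin,
        hcard, hs])
    (by
      intro s hs
      obtain ⟨p, hp, rfl⟩ := Finset.mem_image.1 hs
      have hp := hfin.mem_toFinset.1 hp
      exact (hT p hp).2 _ (hgm p hp))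
    (by
      intro s hs
      obtain ⟨p, hp, rfl⟩ := Finset.mem_image.1 hs
      exact (hg p (hfin.mem_toFinset.1 hp)).1)
    (by
      intro s hs t ht hne hmem
      obtain ⟨p, hp, rfl⟩ := Finset.mem_image.1 hs
      obtain ⟨q, hq, rfl⟩ := Finset.mem_image.1 ht
      have hp := hfin.mem_toFinset.1 hp
      have hq := hfin.mem_toFinset.1 hq
      apply hne
      congr 1
      obtain ⟨c, hc⟩ := Submodule.mem_span_singleton.1 hmem
      have hc0 : c ≠ 0 := by
        rintro rfl
        exact (hg q hq).1 (by rw [← hc, zero_smul])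
      rw [(hg p hp).2, (hg q hq).2, ← hc, Submodule.span_singleton_smul_eq hc0.isUnit])
    (by
      intro r hr
      by_cases hr0 : r = 0
      · have hne : T.Nonempty := Set.nonempty_of_ncard_ne_zero (by omega)
        obtain ⟨p, hp⟩ := hne
        exact ⟨g p, Finset.mem_image_of_mem g (hfin.mem_toFinset.2 hp), by simp [hr0, hypB]⟩
      · obtain ⟨p, hp, hcol⟩ := hno (Submodule.span F {r}) ⟨finrank_span_singleton hr0, by
          intro v hv
          obtain ⟨c, rfl⟩ := Submodule.mem_span_singleton.1 hv
          rw [hQ_smul, hr, mul_zero]⟩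
        exact ⟨g p, Finset.mem_image_of_mem g (hfin.mem_toFinset.2 hp),
          hcol r (Submodule.mem_span_singleton_self r) (g p) (hgm p hp)⟩)
  refine ⟨L, hL1, hL2, fun p hp => ?_⟩
  rw [(hg p hp).2, Submodule.span_singleton_le_iff_mem]
  exact hL3 _ (Finset.mem_image_of_mem g (hfin.mem_toFinset.2 hp))
end

section
/- Let Δ be a polar space of rank at least 3 in which every line has exactly s+1 points, and let T be a set of s+1 distinct points such that every point of Δ is collinear with at least one point of T. If some point p of Δ is collinear with at least two points of T and non-collinear with at least one point of T, then a contradiction arises; consequently every point of Δ is collinear with exactly one or with all points of T (i.e., T is a geometric line). -/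
/-- A polar space (Buekenhout–Shult axioms). -/
structure PolarSpace (P : Type*) where
  lines : Set (Set P)
  linesNonempty : lines.Nonempty
  thickLines : ∀ L ∈ lines, ∃ a b c : P, a ∈ L ∧ b ∈ L ∧ c ∈ L ∧ a ≠ b ∧ a ≠ c ∧ b ≠ c
  oneOrAll : ∀ (p : P), ∀ L ∈ lines,
    (∃! q, q ∈ L ∧ (p = q ∨ ∃ M ∈ lines, p ∈ M ∧ q ∈ M)) ∨
    (∀ q ∈ L, p = q ∨ ∃ M ∈ lines, p ∈ M ∧ q ∈ M)
  nondegenerate : ∀ p : P, ∃ q : P, ¬ (p = q ∨ ∃ M ∈ lines, p ∈ M ∧ q ∈ M)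

/-- Collinearity (a point is collinear with itself). -/
def PolarSpace.collin {P : Type*} (Δ : PolarSpace P) (p q : P) : Prop :=
  p = q ∨ ∃ L ∈ Δ.lines, p ∈ L ∧ q ∈ L

namespace PolarSpace

variable {P : Type*} (Δ : PolarSpace P)

theorem cs {x y : P} (h : Δ.collin x y) : Δ.collin y x := by
  rcases h with h | ⟨L, hL, hx, hy⟩
  · exact Or.inl h.symm
  · exact Or.inr ⟨L, hL, hy, hx⟩

theorem col {L : Set P} (hL : L ∈ Δ.lines) {x y : P} (hx : x ∈ L) (hy : y ∈ L) :
    Δ.collin x y := Or.inr ⟨L, hL, hx, hy⟩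

theorem oa {p : P} {L : Set P} (hL : L ∈ Δ.lines) {x y z : P} (hx : x ∈ L) (hy : y ∈ L)
    (hxy : x ≠ y) (h1 : Δ.collin p x) (h2 : Δ.collin p y) (hz : z ∈ L) : Δ.collin p z := by
  rcases Δ.oneOrAll p L hL with ⟨q, -, hq⟩ | h
  · exact absurd ((hq x ⟨hx, h1⟩).trans (hq y ⟨hy, h2⟩).symm) hxy
  · exact h z hz

theorem exc (p : P) {L : Set P} (hL : L ∈ Δ.lines) : ∃ q ∈ L, Δ.collin p q := by
  rcases Δ.oneOrAll p L hL with ⟨q, hq, -⟩ | h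
  · exact ⟨q, hq⟩
  · obtain ⟨a, _, _, ha, _⟩ := Δ.thickLines L hL
    exact ⟨a, ha, h a ha⟩

theorem two {L : Set P} (hL : L ∈ Δ.lines) (x : P) : ∃ y ∈ L, y ≠ x := by
  obtain ⟨a, b, c, ha, hb, hc, hab, -, -⟩ := Δ.thickLines L hL
  by_cases h : a = x
  · exact ⟨b, hb, fun h' => hab (h.trans h'.symm)⟩
  · exact ⟨a, ha, h⟩

theorem onLine (p : P) : ∃ L ∈ Δ.lines, p ∈ L := by
  obtain ⟨L, hL⟩ := Δ.linesNonempty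
  obtain ⟨q, hq, h⟩ := Δ.exc p hL
  rcases h with h | ⟨M, hM, hp, -⟩
  · exact ⟨L, hL, h ▸ hq⟩
  · exact ⟨M, hM, hp⟩

theorem ln {x y : P} (h : Δ.collin x y) (hne : x ≠ y) : ∃ L ∈ Δ.lines, x ∈ L ∧ y ∈ L :=
  h.resolve_left hne

/-- perps of distinct points are not included in each other -/
theorem nonincl {q x : P} (hne : q ≠ x) : ∃ c, Δ.collin q c ∧ ¬ Δ.collin c x := by
  by_contra! hc
  obtain ⟨N, hN, hqN, hxN⟩ := Δ.ln (hc q (Or.inl rfl)) hne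
  obtain ⟨z, hz⟩ := Δ.nondegenerate x
  change ¬ Δ.collin x z at hz
  have hzq : ¬ Δ.collin q z := fun h => hz (Δ.cs (hc z h))
  obtain ⟨w, hw, hzw⟩ := Δ.exc z hN
  have hqw : ∀ y, Δ.collin q y → Δ.collin y w := fun y hy =>
    Δ.oa hN hqN hxN hne (Δ.cs hy) (hc y hy) hw
  have hwz : z ≠ w := by
    rintro rfl
    exact hz (Δ.col hN hxN hw)
  have hwx : w ≠ x := by
    rintro rfl
    exact hz (Δ.cs hzw)
  have hwq : w ≠ q := by
    rintro rfl
    exact hzq (Δ.cs hzw)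
  obtain ⟨K, hK, hzK, hwK⟩ := Δ.ln hzw hwz
  obtain ⟨v, hv⟩ := Δ.nondegenerate w
  change ¬ Δ.collin w v at hv
  obtain ⟨z', hz'K, hvz'⟩ := Δ.exc v hK
  have hz'w : z' ≠ w := by
    rintro rfl
    exact hv (Δ.cs hvz')
  have hqz' : ¬ Δ.collin q z' := fun h =>
    hzq (Δ.oa hK hwK hz'K hz'w.symm (Δ.col hN hqN hw) h hzK)
  have hne' : v ≠ z' := by
    rintro rfl
    exact hv (Δ.col hK hwK hz'K)
  obtain ⟨J, hJ, hvJ, hz'J⟩ := Δ.ln hvz' hne'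
  obtain ⟨y, hyJ, hqy⟩ := Δ.exc q hJ
  have hyz' : y ≠ z' := by
    rintro rfl
    exact hqz' hqy
  exact hv (Δ.oa hJ hyJ hz'J hyz' (Δ.cs (hqw y hqy)) (Δ.col hK hwK hz'K) hvJ)

theorem uniq {L M : Set P} (hL : L ∈ Δ.lines) (hM : M ∈ Δ.lines) {a b c : P} (hab : a ≠ b)
    (haL : a ∈ L) (hbL : b ∈ L) (haM : a ∈ M) (hbM : b ∈ M) (hcM : c ∈ M) : c ∈ L := by
  by_contra hcL
  have hca : c ≠ a := fun h => hcL (h ▸ haL)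
  have key : ∀ t, Δ.collin t a → Δ.collin t c → ∀ e ∈ L, Δ.collin t e := fun t h1 h2 e he =>
    Δ.oa hL haL hbL hab h1 (Δ.oa hM haM hcM hca.symm h1 h2 hbM) he
  have hcLall : ∀ e ∈ L, Δ.collin c e := key c (Δ.col hM hcM haM) (Or.inl rfl)
  obtain ⟨z, hcz, hza⟩ := Δ.nonincl hca
  obtain ⟨d, hd, hzd⟩ := Δ.exc z hL
  have hcd : c ≠ d := fun h => hcL (h ▸ hd)
  have had : a ≠ d := by
    rintro rfl
    exact hza hzd
  obtain ⟨y, hcy, hyd⟩ := Δ.nonincl hcd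
  have hzned : z ≠ d := by
    rintro rfl
    exact hza (Δ.col hL hd haL)
  obtain ⟨K, hK, hzK, hdK⟩ := Δ.ln hzd hzned
  obtain ⟨z', hz'K, hyz'⟩ := Δ.exc y hK
  have hz'd : z' ≠ d := by
    rintro rfl
    exact hyd hyz'
  have hcz' : Δ.collin c z' := Δ.oa hK hzK hdK hzned hcz (hcLall d hd) hz'K
  have hz'a : ¬ Δ.collin a z' := fun h =>
    hza (Δ.cs (Δ.oa hK hz'K hdK hz'd h (Δ.col hL haL hd) hzK))
  have hdz' : Δ.collin d z' := Δ.col hK hdK hz'K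
  have hne : y ≠ z' := by
    rintro rfl
    exact hyd (Δ.cs hdz')
  obtain ⟨J, hJ, hyJ, hz'J⟩ := Δ.ln hyz' hne
  obtain ⟨t, htJ, hat⟩ := Δ.exc a hJ
  have hct : Δ.collin c t := Δ.oa hJ hyJ hz'J hne hcy hcz' htJ
  have htd := key t (Δ.cs hat) (Δ.cs hct) d hd
  have htz' : t ≠ z' := by
    rintro rfl
    exact hz'a hat
  exact hyd (Δ.cs (Δ.oa hJ htJ hz'J htz' (Δ.cs htd) hdz' hyJ))

theorem count {s : ℕ} {L : Set P} (hL : L ∈ Δ.lines) (hc : L.ncard = s + 1)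
    (F : Finset P) (hF : F.card ≤ s) (h : ∀ x ∈ F, ∃ y ∈ L, ¬ Δ.collin y x) :
    ∃ q ∈ L, ∀ x ∈ F, ¬ Δ.collin q x := by
  by_contra! hcon
  choose! f hf1 hf2 using hcon
  have : L.ncard ≤ (F : Set P).ncard := by
    refine Set.ncard_le_ncard_of_injOn f (fun q hq => hf1 q hq) ?_ F.finite_toSet
    intro q hq r hr hqr
    by_contra hne
    obtain ⟨y, hy, hyx⟩ := h _ (hf1 q hq)
    refine hyx (Δ.cs (Δ.oa hL hq hr hne (Δ.cs (hf2 q hq)) ?_ hy))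
    rw [hqr]
    exact Δ.cs (hf2 r hr)
  rw [Set.ncard_coe_finset] at this
  omega

theorem far {s : ℕ} (hlines : ∀ L ∈ Δ.lines, L.ncard = s + 1) (F : Finset P)
    (hF : F.card ≤ s) : ∃ q, ∀ x ∈ F, ¬ Δ.collin q x := by
  classical
  induction F using Finset.induction_on with
  | empty =>
    obtain ⟨L, hL⟩ := Δ.linesNonempty
    obtain ⟨a, _⟩ := Δ.thickLines L hL
    exact ⟨a, by simp⟩
  | insert a F' ha ih =>
    rw [Finset.card_insert_of_notMem ha] at hF
    have hq : ∃ q, q ≠ a ∧ ∀ x ∈ F', ¬ Δ.collin q x := by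
      obtain ⟨q, hq⟩ := ih (by omega)
      by_cases hqa : q = a
      · subst hqa
        obtain ⟨L, hL, hqL⟩ := Δ.onLine q
        obtain ⟨y, hy, hyq⟩ := Δ.two hL q
        obtain ⟨z, hqz, hzy⟩ := Δ.nonincl hyq.symm
        obtain ⟨r, hr, hr'⟩ := Δ.count hL (hlines L hL) (insert z F')
          ((Finset.card_insert_le _ _).trans hF) (by
            intro x hx
            rcases Finset.mem_insert.1 hx with rfl | hx
            · exact ⟨y, hy, fun h => hzy (Δ.cs h)⟩
            · exact ⟨q, hqL, hq x hx⟩)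
        refine ⟨r, ?_, fun x hx => hr' x (Finset.mem_insert_of_mem hx)⟩
        rintro rfl
        exact hr' z (Finset.mem_insert_self _ _) hqz
      · exact ⟨q, hqa, hq⟩
    obtain ⟨q, hqa, hq⟩ := hq
    by_cases h : Δ.collin q a
    · obtain ⟨c, hqc, hca⟩ := Δ.nonincl hqa
      have hne : q ≠ c := by
        rintro rfl
        exact hca h
      obtain ⟨L, hL, hqL, hcL⟩ := Δ.ln hqc hne
      obtain ⟨r, -, hr⟩ := Δ.count hL (hlines L hL) (insert a F')
          ((Finset.card_insert_le _ _).trans hF) (by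
            intro x hx
            rcases Finset.mem_insert.1 hx with rfl | hx
            · exact ⟨c, hcL, hca⟩
            · exact ⟨q, hqL, hq x hx⟩)
      exact ⟨r, hr⟩
    · refine ⟨q, fun x hx => ?_⟩
      rcases Finset.mem_insert.1 hx with rfl | hx
      · exact h
      · exact hq x hx

/-- a line in the common perp of two opposite points -/
theorem lineR {p o : P} (hpo : ¬ Δ.collin p o) {L : Set P} (hL : L ∈ Δ.lines) (hpL : p ∉ L)
    (h : ∀ x ∈ L, Δ.collin p x) :
    ∃ M ∈ Δ.lines, ∀ x ∈ M, Δ.collin p x ∧ Δ.collin o x := by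
  obtain ⟨x, hx, hox⟩ := Δ.exc o hL
  obtain ⟨y, hy, hyx⟩ := Δ.two hL x
  have hpy : p ≠ y := fun h' => hpL (h' ▸ hy)
  obtain ⟨K, hK, hpK, hyK⟩ := Δ.ln (h y hy) hpy
  obtain ⟨y', hy', hoy'⟩ := Δ.exc o hK
  have hne : x ≠ y' := by
    rintro rfl
    exact hpL (Δ.uniq hL hK hyx hy hx hyK hy' hpK)
  have hc : Δ.collin x y' := Δ.oa hK hpK hyK hpy (Δ.cs (h x hx)) (Δ.col hL hx hy) hy'
  obtain ⟨M, hM, hxM, hyM⟩ := Δ.ln hc hne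
  exact ⟨M, hM, fun u hu => ⟨Δ.oa hM hxM hyM hne (h x hx) (Δ.col hK hpK hy') hu,
    Δ.oa hM hxM hyM hne hox hoy' hu⟩⟩

theorem proj {p o a : P} (hpo : ¬ Δ.collin p o) (hpa : Δ.collin p a) (hne : p ≠ a) :
    ∃ a', Δ.collin p a' ∧ Δ.collin o a' ∧
      ∀ q, Δ.collin p q → (Δ.collin q a ↔ Δ.collin q a') := by
  obtain ⟨K, hK, hpK, haK⟩ := Δ.ln hpa hne
  obtain ⟨a', ha', hoa'⟩ := Δ.exc o hK
  have hne' : p ≠ a' := by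
    rintro rfl
    exact hpo (Δ.cs hoa')
  exact ⟨a', Δ.col hK hpK ha', hoa', fun q hq =>
    ⟨fun h => Δ.oa hK hpK haK hne (Δ.cs hq) h ha',
     fun h => Δ.oa hK hpK ha' hne' (Δ.cs hq) h haK⟩⟩

abbrev RT (p o : P) := {x : P // Δ.collin p x ∧ Δ.collin o x}

theorem liftLine {p o : P} {M : Set P} (hM : ∀ x ∈ M, Δ.collin p x ∧ Δ.collin o x) :
    (Subtype.val '' {x : Δ.RT p o | x.1 ∈ M}) = M := by
  ext x
  constructor
  · rintro ⟨y, hy, rfl⟩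
    exact hy
  · intro hx
    exact ⟨⟨x, hM x hx⟩, hx, rfl⟩

theorem collinR {p o : P} (x y : Δ.RT p o) :
    (x = y ∨ ∃ M ∈ {l : Set (Δ.RT p o) | Subtype.val '' l ∈ Δ.lines}, x ∈ M ∧ y ∈ M) ↔
      Δ.collin x.1 y.1 := by
  constructor
  · rintro (rfl | ⟨M, hM, hx, hy⟩)
    · exact Or.inl rfl
    · exact Or.inr ⟨_, hM, ⟨x, hx, rfl⟩, ⟨y, hy, rfl⟩⟩
  · intro h
    by_cases hxy : x = y
    · exact Or.inl hxy
    · have hne : x.1 ≠ y.1 := fun h => hxy (Subtype.ext h)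
      obtain ⟨L, hL, hx, hy⟩ := Δ.ln h hne
      have hLR : ∀ z ∈ L, Δ.collin p z ∧ Δ.collin o z := fun z hz =>
        ⟨Δ.oa hL hx hy hne x.2.1 y.2.1 hz, Δ.oa hL hx hy hne x.2.2 y.2.2 hz⟩
      refine Or.inr ⟨{z | z.1 ∈ L}, ?_, hx, hy⟩
      change _ ∈ Δ.lines
      rw [Δ.liftLine hLR]
      exact hL

def res {p o : P} (hpo : ¬ Δ.collin p o)
    (hM : ∃ M ∈ Δ.lines, ∀ x ∈ M, Δ.collin p x ∧ Δ.collin o x) : PolarSpace (Δ.RT p o) where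
  lines := {l | Subtype.val '' l ∈ Δ.lines}
  linesNonempty := by
    obtain ⟨M, hM, h⟩ := hM
    refine ⟨{z | z.1 ∈ M}, ?_⟩
    change _ ∈ Δ.lines
    rw [Δ.liftLine h]
    exact hM
  thickLines := by
    intro L hL
    obtain ⟨_, _, _, ⟨a, ha, rfl⟩, ⟨b, hb, rfl⟩, ⟨c, hc, rfl⟩, h1, h2, h3⟩ :=
      Δ.thickLines _ hL
    exact ⟨a, b, c, ha, hb, hc, fun h => h1 (h ▸ rfl), fun h => h2 (h ▸ rfl),
      fun h => h3 (h ▸ rfl)⟩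
  oneOrAll := by
    intro x L hL
    simp only [collinR]
    by_cases hall : ∀ q ∈ L, Δ.collin x.1 q.1
    · exact Or.inr hall
    · left
      obtain ⟨_, ⟨q, hq, rfl⟩, hxq⟩ := Δ.exc x.1 hL
      refine ⟨q, ⟨hq, hxq⟩, ?_⟩
      rintro r ⟨hr, hxr⟩
      by_contra hne
      exact hall fun t ht => Δ.oa hL ⟨r, hr, rfl⟩ ⟨q, hq, rfl⟩
        (fun h => hne (Subtype.ext h)) hxr hxq ⟨t, ht, rfl⟩
  nondegenerate := by
    intro a
    simp only [collinR]
    have hpa : p ≠ a.1 := by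
      intro h
      exact hpo (h ▸ Δ.cs a.2.2)
    obtain ⟨b, hpb, hba⟩ := Δ.nonincl hpa
    have hne : p ≠ b := by
      rintro rfl
      exact hba a.2.1
    obtain ⟨b', h1, h2, h3⟩ := Δ.proj hpo hpb hne
    exact ⟨⟨b', h1, h2⟩, fun h => hba (Δ.cs ((h3 a.1 a.2.1).2 h))⟩

theorem allPlane {s : ℕ} (hlines : ∀ L ∈ Δ.lines, L.ncard = s + 1)
    (hrank : ∃ L ∈ Δ.lines, ∃ p : P, p ∉ L ∧ ∀ x ∈ L, Δ.collin p x) (p : P) :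
    ∃ L ∈ Δ.lines, p ∉ L ∧ ∀ x ∈ L, Δ.collin p x := by
  classical
  have step : ∀ p o, ¬ Δ.collin p o → (∃ L ∈ Δ.lines, p ∉ L ∧ ∀ x ∈ L, Δ.collin p x) →
      ∃ L ∈ Δ.lines, o ∉ L ∧ ∀ x ∈ L, Δ.collin o x := by
    rintro p o hpo ⟨L, hL, hp, h⟩
    obtain ⟨M, hM, h'⟩ := Δ.lineR hpo hL hp h
    exact ⟨M, hM, fun ho => hpo (h' o ho).1, fun x hx => (h' x hx).2⟩
  obtain ⟨L, hL, p0, h0, h1⟩ := hrank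
  have hs : 2 ≤ s := by
    obtain ⟨a, b, c, ha, hb, hc, hab, hac, hbc⟩ := Δ.thickLines L hL
    have hn := hlines L hL
    have hfin : L.Finite := Set.finite_of_ncard_ne_zero (by omega)
    have h3 : ({a, b, c} : Set P).ncard = 3 := Set.ncard_eq_three.2 ⟨a, b, c, hab, hac, hbc, rfl⟩
    have : ({a, b, c} : Set P).ncard ≤ L.ncard := by
      refine Set.ncard_le_ncard ?_ hfin
      rintro x (rfl | rfl | rfl) <;> assumption
    omega
  obtain ⟨u, hu⟩ := Δ.far hlines {p0, p} (Finset.card_le_two.trans hs)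
  exact step u p (hu p (by simp))
    (step p0 u (fun h => hu p0 (by simp) (Δ.cs h)) ⟨L, hL, h0, h1⟩)

theorem farRes {s : ℕ} (hlines : ∀ L ∈ Δ.lines, L.ncard = s + 1)
    (hrank : ∃ L ∈ Δ.lines, ∃ p : P, p ∉ L ∧ ∀ x ∈ L, Δ.collin p x) (p : P)
    (F : Finset P) (hF : F.card ≤ s) (hFp : ∀ x ∈ F, Δ.collin p x ∧ p ≠ x) :
    ∃ q, Δ.collin p q ∧ ∀ x ∈ F, ¬ Δ.collin q x := by
  classical
  obtain ⟨L, hL, hpL, hall⟩ := Δ.allPlane hlines hrank p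
  obtain ⟨o, hpo⟩ := Δ.nondegenerate p
  change ¬ Δ.collin p o at hpo
  have hM := Δ.lineR hpo hL hpL hall
  have hpr : ∀ a : F, ∃ a' : Δ.RT p o, ∀ q, Δ.collin p q →
      (Δ.collin q a.1 ↔ Δ.collin q a'.1) := by
    intro a
    obtain ⟨a', h1, h2, h3⟩ := Δ.proj hpo (hFp a.1 a.2).1 (hFp a.1 a.2).2
    exact ⟨⟨a', h1, h2⟩, h3⟩
  choose f hf using hpr
  obtain ⟨q, hq⟩ := (Δ.res hpo hM).far (s := s) (by
    intro l hl
    rw [← hlines _ hl, Set.ncard_image_of_injective _ Subtype.val_injective])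
    (Finset.univ.image f) (Finset.card_image_le.trans (by simpa using hF))
  refine ⟨q.1, q.2.1, fun x hx h => ?_⟩
  exact hq (f ⟨x, hx⟩) (by simp) ((Δ.collinR q _).2 ((hf ⟨x, hx⟩ q.1 q.2.1).1 h))

end PolarSpace

/-- In a polar space of rank at least `3` (there is a point collinear with all
points of a line not through it, producing singular planes) in which every line
has exactly `s+1` points, if `T` is a set of `s+1` points such that every point
of the space is collinear with at least one point of `T`, then every point is
collinear with exactly one or with all points of `T`: `T` is a geometric line. -/
theorem stmt11 {P : Type*} (Δ : PolarSpace P) (s : ℕ)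
    (hlines : ∀ L ∈ Δ.lines, L.ncard = s + 1)
    (hrank : ∃ L ∈ Δ.lines, ∃ p : P, p ∉ L ∧ ∀ x ∈ L, Δ.collin p x)
    (T : Set P) (hcard : T.ncard = s + 1)
    (hblock : ∀ p : P, ∃ x ∈ T, Δ.collin p x) :
    ∀ p : P, (∀ x ∈ T, Δ.collin p x) ∨ (∃! x, x ∈ T ∧ Δ.collin p x) := by
  classical
  have hfin : T.Finite := Set.finite_of_ncard_ne_zero (by omega)
  obtain ⟨T, rfl⟩ := hfin.exists_finset_coe
  rw [Set.ncard_coe_finset] at hcard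
  simp only [Finset.mem_coe] at *
  -- a good line through `p`
  have good : ∀ p a b, a ∈ T → b ∈ T → a ≠ p → Δ.collin p a → ¬ Δ.collin p b →
      ∃ L ∈ Δ.lines, p ∈ L ∧ ∀ x ∈ T, x ≠ p → ∃ y ∈ L, ¬ Δ.collin y x := by
    intro p a b ha hb hap hpa hpb
    obtain ⟨q, hpq, hq⟩ := Δ.farRes hlines hrank p (T.filter fun x => Δ.collin p x ∧ p ≠ x)
      (by
        have : (T.filter fun x => Δ.collin p x ∧ p ≠ x) ⊂ T :=
          Finset.filter_ssubset.2 ⟨b, hb, fun h => hpb h.1⟩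
        have := Finset.card_lt_card this
        omega) (fun x hx => (Finset.mem_filter.1 hx).2)
    have hne : p ≠ q := by
      rintro rfl
      exact hq a (Finset.mem_filter.2 ⟨ha, hpa, hap.symm⟩) hpa
    obtain ⟨L, hL, hpL, hqL⟩ := Δ.ln hpq hne
    refine ⟨L, hL, hpL, fun x hx hxp => ?_⟩
    by_cases h : Δ.collin p x
    · exact ⟨q, hqL, hq x (Finset.mem_filter.2 ⟨hx, h, hxp.symm⟩)⟩
    · exact ⟨p, hpL, h⟩
  have case1 : ∀ p, p ∉ T → ∀ a a' b, a ∈ T → a' ∈ T → b ∈ T → a ≠ a' → Δ.collin p a →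
      Δ.collin p a' → Δ.collin p b := by
    intro p hpT a a' b ha ha' hb haa' hpa hpa'
    by_contra hpb
    have hT : ∀ x ∈ T, x ≠ p := fun x hx h => hpT (h ▸ hx)
    obtain ⟨L, hL, hpL, hgood⟩ := good p a b ha hb (hT a ha) hpa hpb
    have hsub : insert a (T.filter fun x => ¬ Δ.collin p x) ⊂ T := by
      refine (Finset.ssubset_iff_of_subset ?_).2 ⟨a', ha', ?_⟩
      · intro x hx
        rcases Finset.mem_insert.1 hx with rfl | hx
        · exact ha
        · exact (Finset.mem_filter.1 hx).1
      · intro h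
        rcases Finset.mem_insert.1 h with h | h
        · exact haa' h.symm
        · exact (Finset.mem_filter.1 h).2 hpa'
    have hcd := Finset.card_lt_card hsub
    obtain ⟨q, hqL, hq⟩ := Δ.count hL (hlines L hL) _ (by omega : _ ≤ s)
      (fun x hx => hgood x (hsub.1 hx) (hT x (hsub.1 hx)))
    obtain ⟨t, ht, hqt⟩ := hblock q
    have hpt : Δ.collin p t := by
      by_contra h
      exact hq t (Finset.mem_insert_of_mem (Finset.mem_filter.2 ⟨ht, h⟩)) hqt
    have hqp : q ≠ p := by
      rintro rfl
      exact hq a (Finset.mem_insert_self _ _) hpa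
    obtain ⟨y, hy, hyt⟩ := hgood t ht (hT t ht)
    exact hyt (Δ.cs (Δ.oa hL hqL hpL hqp (Δ.cs hqt) (Δ.cs hpt) hy))
  have case2 : ∀ p, p ∈ T → ∀ a b, a ∈ T → b ∈ T → a ≠ p → Δ.collin p a →
      Δ.collin p b := by
    intro p hpT a b ha hb hap hpa
    by_contra hpb
    obtain ⟨L, hL, hpL, hgood⟩ := good p a b ha hb hap hpa hpb
    obtain ⟨r, hr, hbr⟩ := Δ.exc b hL
    have hrp : r ≠ p := by
      rintro rfl
      exact hpb (Δ.cs hbr)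
    have hbp : b ≠ p := by
      rintro rfl
      exact hpb (Or.inl rfl)
    have hrT : r ∉ T := by
      intro hrT
      obtain ⟨y, hy, hyr⟩ := hgood r hrT hrp
      exact hyr (Δ.col hL hy hr)
    have hra := case1 r hrT b p a hb hpT ha hbp (Δ.cs hbr) (Δ.col hL hr hpL)
    obtain ⟨y, hy, hya⟩ := hgood a ha hap
    exact hya (Δ.cs (Δ.oa hL hr hpL hrp (Δ.cs hra) (Δ.cs hpa) hy))
  intro p
  by_cases hall : ∀ x ∈ T, Δ.collin p x
  · exact Or.inl hall
  · right
    obtain ⟨a, ha, hpa⟩ := hblock p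
    refine ⟨a, ⟨ha, hpa⟩, ?_⟩
    rintro a' ⟨ha', hpa'⟩
    by_contra hne
    refine hall fun b hb => ?_
    by_cases hpT : p ∈ T
    · by_cases hap : a = p
      · exact case2 p hpT a' b ha' hb (fun h => hne (h.trans hap.symm)) hpa'
      · exact case2 p hpT a b ha hb hap hpa
    · exact case1 p hpT a' a b ha' ha hb hne hpa' hpa
end
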